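/- Let F be a d-dimensional inner product distribution with (A,X) ~ RDPG(F,n). Let F̂_n = n^{-1} Σ_{i=1}^n δ_{X̂ᵢ} denote the empirical distribution of the rows of X̂ = ASE(A,d), and conditional on A generate Â* ~ RDPG(F̂_n,n). If (H,Z) ~ RDPG(F,n) is an independent copy of (A,X), then for every p ≥ 1, W_{GM,p}^p(Â*, H) = O((n^{-1/2} + n^{-1/d}) log n). -/

import Mathlib

open MeasureTheory Filter Matrix
open scoped BigOperators NNReal ENNReal Topology Classical

noncomputable section

/-- Dot product on `Fin d → ℝ`. -/
def dotd {d : ℕ} (x y : Fin d → ℝ) : ℝ := ∑ k, x k * y k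

/-- Euclidean norm on `Fin d → ℝ`. -/
def euclNorm {d : ℕ} (x : Fin d → ℝ) : ℝ := Real.sqrt (∑ k, (x k) ^ 2)

/-- Support of a measure on a topological space. -/
def msupport {α : Type*} [TopologicalSpace α] [MeasurableSpace α] (μ : Measure α) : Set α :=
  {x | ∀ U : Set α, IsOpen U → x ∈ U → 0 < μ U}

/-- `F` is a `d`-dimensional inner product distribution. -/
def InnerProductDistribution (d : ℕ) (F : Measure (Fin d → ℝ)) : Prop :=
  IsProbabilityMeasure F ∧
    ∀ x ∈ msupport F, ∀ y ∈ msupport F, 0 ≤ dotd x y ∧ dotd x y ≤ 1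

/-- Auxiliary i.i.d. uniform randomness on `[0,1]`, indexed by pairs of vertices. -/
def pairUniform (n : ℕ) : Measure ((Fin n × Fin n) → ℝ) :=
  Measure.pi fun _ => volume.restrict (Set.Icc (0:ℝ) 1)

/-- The adjacency matrix built from latent positions `X`, sparsity scale `ρ`, and auxiliary
uniform variables `u`: conditional on `X`, the entries above the diagonal are independent
`Bernoulli(ρ ⟨X i, X j⟩)`, and the matrix is symmetric and hollow. -/
def adjOf {d n : ℕ} (ρ : ℝ) (X : Fin n → Fin d → ℝ) (u : (Fin n × Fin n) → ℝ) :
    Fin n → Fin n → ℝ := fun i j =>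
  if i = j then 0 else if u (min i j, max i j) < ρ * dotd (X i) (X j) then 1 else 0

/-- The joint law of `(A, X)` for a (possibly sparse) random dot product graph whose latent
positions have joint law `μX`. -/
def rdpgLawOf {d n : ℕ} (ρ : ℝ) (μX : Measure (Fin n → Fin d → ℝ)) :
    Measure ((Fin n → Fin n → ℝ) × (Fin n → Fin d → ℝ)) :=
  Measure.map (fun p => (adjOf ρ p.2 p.1, p.2)) ((pairUniform n).prod μX)

/-- The joint law of `(A,X) ~ RDPG(F, n)`. -/
def rdpgLaw (d n : ℕ) (F : Measure (Fin d → ℝ)) [SigmaFinite F] :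
    Measure ((Fin n → Fin n → ℝ) × (Fin n → Fin d → ℝ)) :=
  rdpgLawOf 1 (Measure.pi fun _ : Fin n => F)

/-- `(A, X) ~ RDPG(F, n)` for random variables `A, X` on a probability space `(Ω, P)`. -/
def HasRDPGLaw {Ω : Type*} [MeasurableSpace Ω] (P : Measure Ω) {d n : ℕ}
    (F : Measure (Fin d → ℝ)) [SigmaFinite F] (A : Ω → Fin n → Fin n → ℝ)
    (X : Ω → Fin n → Fin d → ℝ) : Prop :=
  Measure.map (fun ω => (A ω, X ω)) P = rdpgLaw d n F

/-- The marginal law of the adjacency matrix of an `RDPG(F,n)`. -/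
def adjLaw (d n : ℕ) (F : Measure (Fin d → ℝ)) [SigmaFinite F] :
    Measure (Fin n → Fin n → ℝ) :=
  (rdpgLaw d n F).map Prod.fst

/-- The law of the adjacency matrix for fixed latent positions `x`. -/
def adjLawFixed {d : ℕ} (n : ℕ) (x : Fin n → Fin d → ℝ) : Measure (Fin n → Fin n → ℝ) :=
  Measure.map (fun u => adjOf 1 x u) (pairUniform n)

/-- `Xh` is an adjacency spectral embedding of `A` into dimension `d`: its columns are
orthonormal eigenvectors of `A` corresponding to the `d` largest-in-magnitude eigenvalues,
scaled by the square roots of the absolute eigenvalues. -/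
def IsASE {n d : ℕ} (A : Fin n → Fin n → ℝ) (Xh : Fin n → Fin d → ℝ) : Prop :=
  ∃ (lam : Fin d → ℝ) (U : Fin n → Fin d → ℝ),
    (∀ j j', (∑ i, U i j * U i j') = if j = j' then (1:ℝ) else 0) ∧
    (∀ j, (Matrix.of A).mulVec (fun i => U i j) = fun i => lam j * U i j) ∧
    (∀ (mu : ℝ) (v : Fin n → ℝ), v ≠ 0 → (Matrix.of A).mulVec v = mu • v →
      (∀ j, (∑ i, v i * U i j) = 0) → ∀ j, |mu| ≤ |lam j|) ∧
    (∀ i j, Xh i j = U i j * Real.sqrt |lam j|)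

/-- A choice of adjacency spectral embedding of `A` into dimension `d`. -/
def ase (d : ℕ) {n : ℕ} (A : Fin n → Fin n → ℝ) : Fin n → Fin d → ℝ :=
  if h : ∃ Xh, IsASE A Xh then h.choose else 0

/-- The U-statistic with kernel `h` of the points `Y 1, …, Y n`. -/
def Ustat {d : ℕ} (m n : ℕ) (h : (Fin m → Fin d → ℝ) → ℝ) (Y : Fin n → Fin d → ℝ) : ℝ :=
  ((n.choose m : ℝ))⁻¹ * ∑ c : Fin m → Fin n,
    if StrictMono c then h (fun k => Y (c k)) else 0

/-- The weighted (bootstrapped) U-statistic with kernel `h` and weights `W` (indexed by the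
strictly increasing `m`-tuples). -/
def UstatW {d : ℕ} (m n : ℕ) (h : (Fin m → Fin d → ℝ) → ℝ)
    (W : (Fin m → Fin n) → ℝ) (Y : Fin n → Fin d → ℝ) : ℝ :=
  ((n.choose m : ℝ))⁻¹ * ∑ c : Fin m → Fin n,
    if StrictMono c then W c * h (fun k => Y (c k)) else 0

/-- `max_{c ∈ C^n_m} |W c|`. -/
def maxAbsWeight {m n : ℕ} (W : (Fin m → Fin n) → ℝ) : ℝ :=
  ⨆ c : Fin m → Fin n, if StrictMono c then |W c| else 0

/-- `h` is symmetric in its `m` arguments. -/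
def SymmetricKernel {d m : ℕ} (h : (Fin m → Fin d → ℝ) → ℝ) : Prop :=
  ∀ (σ : Equiv.Perm (Fin m)) (x : Fin m → Fin d → ℝ), h (x ∘ σ) = h x

/-- Assumption H1: `h` is invariant under simultaneous orthogonal transformation of
its arguments. -/
def AssumptionH1 {d m : ℕ} (h : (Fin m → Fin d → ℝ) → ℝ) : Prop :=
  ∀ Q : Matrix (Fin d) (Fin d) ℝ, Qᵀ * Q = 1 →
    ∀ x : Fin m → Fin d → ℝ, h (fun k => Q.mulVec (x k)) = h x

/-- Assumption H2 relative to a set `K₀ ⊆ ℝ^d`: viewing `h` as a function on `ℝ^{md}`,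
`h` is twice continuously differentiable on an open neighborhood `S` of `K₀^m` on which its
Hessian is bounded in norm, and the Hessian is continuous on the closure of `K₀^m`. -/
def AssumptionH2On {d m : ℕ} (K₀ : Set (Fin d → ℝ)) (h : (Fin m → Fin d → ℝ) → ℝ) : Prop :=
  ∃ S : Set (Fin m → Fin d → ℝ), IsOpen S ∧ {x | ∀ k, x k ∈ K₀} ⊆ S ∧
    ContDiffOn ℝ 2 h S ∧
    ContinuousOn (iteratedFDeriv ℝ 2 h) (closure {x | ∀ k, x k ∈ K₀}) ∧
    ∃ C : ℝ, ∀ x ∈ S, ‖iteratedFDeriv ℝ 2 h x‖ ≤ C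

/-- Assumption H2 for an RDPG with latent position distribution `F`. -/
def AssumptionH2 {d m : ℕ} (F : Measure (Fin d → ℝ)) (h : (Fin m → Fin d → ℝ) → ℝ) : Prop :=
  AssumptionH2On (msupport F) h

/-- `θ(F) = E h(X₁, …, X_m)` for `X₁, …, X_m` i.i.d. `F`. -/
def thetaOf {d : ℕ} (m : ℕ) (F : Measure (Fin d → ℝ)) [SigmaFinite F]
    (h : (Fin m → Fin d → ℝ) → ℝ) : ℝ :=
  ∫ x, h x ∂(Measure.pi fun _ : Fin m => F)

/-- The conditional expectation kernel `h₁(z) = E h(z, X₂, …, X_m)`. -/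
def kern1 {d : ℕ} (m : ℕ) (hm : 0 < m) (F : Measure (Fin d → ℝ)) [SigmaFinite F]
    (h : (Fin m → Fin d → ℝ) → ℝ) (z : Fin d → ℝ) : ℝ :=
  ∫ x, h (Function.update x (⟨0, hm⟩ : Fin m) z) ∂(Measure.pi fun _ : Fin m => F)

/-- `ζ₁ = E (E[h(X₁,…,X_m) ∣ X₁] − θ)²`. -/
def zeta1 {d : ℕ} (m : ℕ) (hm : 0 < m) (F : Measure (Fin d → ℝ)) [SigmaFinite F]
    (h : (Fin m → Fin d → ℝ) → ℝ) : ℝ :=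
  ∫ z, (kern1 m hm F h z - thetaOf m F h) ^ 2 ∂F

/-- Weak convergence (convergence in distribution) of a sequence of real random variables
`T n` on `(Ω, P)` to the law `μ`, tested against bounded continuous functions. -/
def TendstoInDistribution {Ω : Type*} [MeasurableSpace Ω] (P : Measure Ω)
    (T : ℕ → Ω → ℝ) (μ : Measure ℝ) : Prop :=
  ∀ g : BoundedContinuousFunction ℝ ℝ,
    Tendsto (fun n => ∫ ω, g (T n ω) ∂P) atTop (𝓝 (∫ x, g x ∂μ))

/-- The uniform distribution on `Fin n`. -/
def uniformFin (n : ℕ) : Measure (Fin n) := ((n : ℝ≥0))⁻¹ • Measure.count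

/-- The empirical distribution of the points `Y 1, …, Y n`. -/
def empMeasure {d n : ℕ} (Y : Fin n → Fin d → ℝ) : Measure (Fin d → ℝ) :=
  ((n : ℝ≥0))⁻¹ • ∑ i : Fin n, Measure.dirac (Y i)

instance {d n : ℕ} (Y : Fin n → Fin d → ℝ) : IsFiniteMeasure (empMeasure Y) := by
  unfold empMeasure; infer_instance

/-- The law of the bootstrapped network `Â*`: having observed `A ~ RDPG(F,n)` (in its
adjacency marginal), draw `Â* ~ RDPG(F̂_n, n)` where `F̂_n` is the empirical distribution
of the rows of the adjacency spectral embedding of `A`. -/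
def bootLaw (d n : ℕ) (F : Measure (Fin d → ℝ)) [SigmaFinite F] :
    Measure (Fin n → Fin n → ℝ) :=
  (adjLaw d n F).bind fun a => adjLaw d n (empMeasure (ase d a))

/-- `ρ̂ = binom(n,2)⁻¹ Σ_{i<j} A_{ij}`, the empirical edge density. -/
def rhoHat {n : ℕ} (A : Fin n → Fin n → ℝ) : ℝ :=
  ((n.choose 2 : ℝ))⁻¹ * ∑ i, ∑ j, if i < j then A i j else 0

/-- The (normalized) average degree. -/
def avgDegree {n : ℕ} (A : Fin n → Fin n → ℝ) : ℝ :=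
  (n : ℝ)⁻¹ * ∑ i, (∑ j, if j ≠ i then A i j else 0) / ((n : ℝ) - 1)

/-- The subgraph-counting kernel `h_R` associated with a graph `R` on `m` vertices. -/
def subgraphKernel {m : ℕ} (d : ℕ) (R : SimpleGraph (Fin m)) (x : Fin m → Fin d → ℝ) : ℝ :=
  ((Nat.card {G : SimpleGraph (Fin m) // Nonempty (G ≃g R)} : ℝ))⁻¹ *
    ∑ τ : Equiv.Perm (Fin m), ∏ p : Fin m × Fin m,
      if p.1 < p.2 then
        (if R.Adj p.1 p.2 then dotd (x (τ p.1)) (x (τ p.2))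
          else 1 - dotd (x (τ p.1)) (x (τ p.2)))
      else 1

/-- The empirical subgraph density `P̂(R)` of `R` in the graph with adjacency matrix `A`:
the proportion of `m`-subsets of vertices whose induced subgraph is isomorphic to `R`. -/
def subgraphDensity {m n : ℕ} (R : SimpleGraph (Fin m)) (A : Fin n → Fin n → ℝ) : ℝ :=
  ((n.choose m : ℝ))⁻¹ * ∑ c : Fin m → Fin n,
    if StrictMono c ∧ (∃ σ : Equiv.Perm (Fin m), ∀ k l : Fin m, k ≠ l →
        (A (c (σ k)) (c (σ l)) = 1 ↔ R.Adj k l)) then (1:ℝ) else 0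

/-- The entrywise ℓ¹ norm of a matrix. -/
def matL1 {n : ℕ} (M : Fin n → Fin n → ℝ) : ℝ := ∑ i, ∑ j, |M i j|

/-- The graph matching distance between two `n`-vertex graphs. -/
def dGM {n : ℕ} (A B : Fin n → Fin n → ℝ) : ℝ :=
  ⨅ σ : Equiv.Perm (Fin n),
    ((n.choose 2 : ℝ))⁻¹ * (∑ i, ∑ j, |A i j - B (σ i) (σ j)|) / 2

/-- The set of couplings of two measures. -/
def Couplings {α β : Type*} [MeasurableSpace α] [MeasurableSpace β]
    (μ : Measure α) (ν : Measure β) : Set (Measure (α × β)) :=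
  {γ | IsProbabilityMeasure γ ∧ γ.map Prod.fst = μ ∧ γ.map Prod.snd = ν}

/-- `W_{GM,p}^p`: the `p`-th power of the graph-matching Wasserstein distance between two
laws of random adjacency matrices. -/
def WGMpow {n : ℕ} (p : ℝ) (μ ν : Measure (Fin n → Fin n → ℝ)) : ℝ :=
  sInf ((fun γ => ∫ q, dGM q.1 q.2 ^ p ∂γ) '' Couplings μ ν)

/-- The Wasserstein `p`-distance between two distributions on `ℝ^d` (with Euclidean cost). -/
def wassersteinP {d : ℕ} (p : ℝ) (μ ν : Measure (Fin d → ℝ)) : ℝ :=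
  sInf ((fun γ => (∫ q, euclNorm (q.1 - q.2) ^ p ∂γ) ^ (1/p)) '' Couplings μ ν)

/-- `d̊_p(F₁,F₂) = min_{Q ∈ O(d)} d_p(F₁, F₂ ∘ Q)`. -/
def ringWasserstein {d : ℕ} (p : ℝ) (μ ν : Measure (Fin d → ℝ)) : ℝ :=
  sInf {r | ∃ Q : Matrix (Fin d) (Fin d) ℝ, Qᵀ * Q = 1 ∧
    r = wassersteinP p μ (ν.map fun x => Q.mulVec x)}

/-- The Frobenius norm of a matrix. -/
def frobNorm {n d : ℕ} (M : Matrix (Fin n) (Fin d) ℝ) : ℝ :=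
  Real.sqrt (∑ i, ∑ j, (M i j) ^ 2)

/-- The `2→∞` norm of a matrix: the maximum Euclidean norm of a row. -/
def twoInftyNorm {n d : ℕ} (M : Matrix (Fin n) (Fin d) ℝ) : ℝ := ⨆ i, euclNorm (M i)

/-- `U`, `lam` form a rank-`d` spectral decomposition of the symmetric matrix `Pm`:
the columns of `U` are orthonormal eigenvectors with eigenvalues `lam`, and
`Pm = U · diag(lam) · Uᵀ`. -/
def IsSpecDecomp {n d : ℕ} (Pm : Fin n → Fin n → ℝ) (U : Fin n → Fin d → ℝ)
    (lam : Fin d → ℝ) : Prop :=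
  (∀ j j', (∑ i, U i j * U i j') = if j = j' then (1:ℝ) else 0) ∧
  (∀ j, (Matrix.of Pm).mulVec (fun i => U i j) = fun i => lam j * U i j) ∧
  (∀ i i', Pm i i' = ∑ j, U i j * lam j * U i' j)

/-- `U`, `lam` are orthonormal eigenvectors of `A` for its `d` largest-in-magnitude
eigenvalues. -/
def IsTopSpec {n d : ℕ} (A : Fin n → Fin n → ℝ) (U : Fin n → Fin d → ℝ)
    (lam : Fin d → ℝ) : Prop :=
  (∀ j j', (∑ i, U i j * U i j') = if j = j' then (1:ℝ) else 0) ∧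
  (∀ j, (Matrix.of A).mulVec (fun i => U i j) = fun i => lam j * U i j) ∧
  (∀ (mu : ℝ) (v : Fin n → ℝ), v ≠ 0 → (Matrix.of A).mulVec v = mu • v →
    (∀ j, (∑ i, v i * U i j) = 0) → ∀ j, |mu| ≤ |lam j|)

/-- The `2→∞` bound with constant `C`: `max_i ‖Qᵀ Xh_i − X_i‖ ≤ C log n / √n`. -/
def TwoToInftyBound {n d : ℕ} (C : ℝ) (Xh X : Fin n → Fin d → ℝ)
    (Q : Matrix (Fin d) (Fin d) ℝ) : Prop :=
  ∀ i, euclNorm (Qᵀ.mulVec (Xh i) - X i) ≤ C * Real.log n / Real.sqrt n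

/-- The second moment matrix `Δ = E X₁ X₁ᵀ` of a distribution `F` on `ℝ^d`. -/
def secondMoment {d : ℕ} (F : Measure (Fin d → ℝ)) : Matrix (Fin d) (Fin d) ℝ :=
  Matrix.of fun i j => ∫ x, x i * x j ∂F


lemma card_agree_split {ι κ : Type*} [Fintype ι] (x y : ι → κ) (k m : ι) (hkm : k ≠ m) :
    (Finset.univ.filter fun i => x i = y i).card =
      (if x k = y k then 1 else 0) + ((if x m = y m then 1 else 0) +
        ∑ i ∈ (Finset.univ.erase k).erase m, if x i = y i then 1 else 0) := by
  rw [Finset.card_filter, ← Finset.add_sum_erase _ _ (Finset.mem_univ k),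
    ← Finset.add_sum_erase _ _ (Finset.mem_erase.2 ⟨hkm.symm, Finset.mem_univ m⟩)]

lemma exists_matching {ι κ : Type*} [Fintype ι] (L : ℕ) (a b : ℕ → ι → κ)
    (hnest : ∀ l k m, a (l+1) k = b (l+1) m → a l k = b l m) :
    ∃ σ : Equiv.Perm ι, ∀ l ≤ L, ∀ S : Finset κ, (∀ k, a l k ∈ S) →
      ((Finset.univ.filter fun k => a l k ≠ b l (σ k)).card : ℝ) ≤
        ∑ Q ∈ S, |((Finset.univ.filter fun k => a l k = Q).card : ℝ)
          - ((Finset.univ.filter fun k => b l k = Q).card : ℝ)| := by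
  have hnest' : ∀ l l' k m, l ≤ l' → a l' k = b l' m → a l k = b l m := by
    intro l l' k m h
    induction l', h using Nat.le_induction with
    | base => exact id
    | succ l' _ ih => exact fun h => ih (hnest _ _ _ h)
  obtain ⟨σ, hσ⟩ := Finite.exists_max (fun σ : Equiv.Perm ι =>
    ∑ l ∈ Finset.range (L+1), (Finset.univ.filter fun k => a l k = b l (σ k)).card)
  have key : ∀ l ≤ L, ∀ k m, a l k ≠ b l (σ k) → a l m ≠ b l (σ m) → a l k ≠ b l (σ m) := by
    intro l hl k m hk hm hkm
    have hne : k ≠ m := by rintro rfl; exact hk hkm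
    refine absurd (hσ (σ * Equiv.swap k m)) (not_le.2 ?_)
    have e1 : (σ * Equiv.swap k m) k = σ m := by simp
    have e2 : (σ * Equiv.swap k m) m = σ k := by simp
    have rest : ∀ l', (∑ i ∈ (Finset.univ.erase k).erase m,
        if a l' i = b l' ((σ * Equiv.swap k m) i) then 1 else 0) =
        ∑ i ∈ (Finset.univ.erase k).erase m, if a l' i = b l' (σ i) then 1 else 0 := by
      intro l'
      refine Finset.sum_congr rfl fun i hi => ?_
      simp only [Finset.mem_erase, Finset.mem_univ, and_true] at hi
      rw [Equiv.Perm.mul_apply, Equiv.swap_apply_of_ne_of_ne hi.2 hi.1]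
    apply Finset.sum_lt_sum
    · intro l' hl'
      rw [card_agree_split _ (fun i => b l' (σ i)) k m hne,
        card_agree_split _ (fun i => b l' ((σ * Equiv.swap k m) i)) k m hne, rest l']
      simp only [e1, e2]
      rcases le_total l' l with h | h
      · have h1 := hnest' l' l k m
        have h2 : a l' k = b l' (σ m) := hnest' l' l k (σ m) h hkm
        by_cases h3 : a l' k = b l' (σ k) <;> by_cases h4 : a l' m = b l' (σ m) <;>
          simp [h2, h4] <;> grind
      · have h3 : a l' k ≠ b l' (σ k) := fun h' => hk (hnest' _ _ _ _ h h')
        have h4 : a l' m ≠ b l' (σ m) := fun h' => hm (hnest' _ _ _ _ h h')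
        simp only [h3, h4, if_false]
        omega
    · refine ⟨l, Finset.mem_range.2 (by omega), ?_⟩
      rw [card_agree_split _ (fun i => b l (σ i)) k m hne,
        card_agree_split _ (fun i => b l ((σ * Equiv.swap k m) i)) k m hne, rest l]
      simp only [e1, e2]
      rw [if_neg hk, if_neg hm, if_pos hkm]
      omega
  refine ⟨σ, fun l hl S hS => ?_⟩
  have hsum : ((Finset.univ.filter fun k => a l k ≠ b l (σ k)).card : ℝ) =
      ∑ Q ∈ S, ((Finset.univ.filter fun k => a l k = Q ∧ a l k ≠ b l (σ k)).card : ℝ) := by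
    rw [Finset.card_eq_sum_card_fiberwise (f := a l) (t := S) (fun k _ => hS k)]
    push_cast
    refine Finset.sum_congr rfl fun Q _ => ?_
    rw [Finset.filter_filter]
    congr 2
    ext k; simp [and_comm]
  rw [hsum]
  refine Finset.sum_le_sum fun Q _ => ?_
  by_cases hQ : ∃ k, a l k = Q ∧ a l k ≠ b l (σ k)
  · obtain ⟨k, rfl, hk⟩ := hQ
    have hb : (Finset.univ.filter fun m => b l m = a l k).card =
        (Finset.univ.filter fun m => b l (σ m) = a l k).card := by
      refine (Finset.card_bij (fun m _ => σ m) ?_ ?_ ?_).symm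
      · intro m hm; simpa using hm
      · intro m _ m' _ h; exact σ.injective h
      · intro m hm; exact ⟨σ.symm m, by simpa using hm, by simp⟩
    rw [hb]
    have hsub : (Finset.univ.filter fun m => b l (σ m) = a l k).card
        + (Finset.univ.filter fun m => a l m = a l k ∧ a l m ≠ b l (σ m)).card
        ≤ (Finset.univ.filter fun m => a l m = a l k).card := by
      rw [← Finset.card_union_of_disjoint]
      · apply Finset.card_le_card
        intro m hm
        simp only [Finset.mem_union, Finset.mem_filter, Finset.mem_univ, true_and] at hm ⊢
        rcases hm with hm | hm
        · by_contra hne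
          exact key l hl k m hk (fun h => hne (h.trans hm)) hm.symm
        · exact hm.1
      · rw [Finset.disjoint_left]
        intro m hm hm'
        simp only [Finset.mem_filter, Finset.mem_univ, true_and] at hm hm'
        exact hm'.2 (hm'.1.trans hm.symm)
    have := (Nat.cast_le (α := ℝ)).2 hsub
    push_cast at this
    exact le_trans (by linarith) (le_abs_self _)
  · push Not at hQ
    have : (Finset.univ.filter fun k => a l k = Q ∧ a l k ≠ b l (σ k)) = ∅ := by
      ext k; simp; exact hQ k
    rw [this]; simp

section

open scoped Matrix.Norms.L2Operator

lemma opn_sq {m n : ℕ} (M : Matrix (Fin m) (Fin n) ℝ) (w : Fin n → ℝ) :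
    (M *ᵥ w) ⬝ᵥ (M *ᵥ w) ≤ ‖M‖ ^ 2 * (w ⬝ᵥ w) := by
  have h := Matrix.l2_opNorm_mulVec M (WithLp.toLp 2 w)
  have h2 := pow_le_pow_left₀ (norm_nonneg _) h 2
  rw [mul_pow, EuclideanSpace.norm_sq_eq, EuclideanSpace.norm_sq_eq] at h2
  simp only [dotProduct, ← sq]
  simpa [sq_abs] using h2

lemma opn_abs {n : ℕ} (M : Matrix (Fin n) (Fin n) ℝ) (w : Fin n → ℝ) :
    |w ⬝ᵥ (M *ᵥ w)| ≤ ‖M‖ * (w ⬝ᵥ w) := by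
  have h1 := opn_sq M w
  have h2 : (w ⬝ᵥ (M *ᵥ w)) ^ 2 ≤ (w ⬝ᵥ w) * ((M *ᵥ w) ⬝ᵥ (M *ᵥ w)) := by
    have := Finset.sum_mul_sq_le_sq_mul_sq Finset.univ w (M *ᵥ w)
    simpa [dotProduct, ← sq] using this
  have h0 : 0 ≤ w ⬝ᵥ w := by
    simp only [dotProduct]; exact Finset.sum_nonneg fun i _ => mul_self_nonneg _
  apply abs_le_of_sq_le_sq _ (mul_nonneg (norm_nonneg _) h0)
  calc _ ≤ _ := h2
    _ ≤ (w ⬝ᵥ w) * (‖M‖ ^ 2 * (w ⬝ᵥ w)) := by gcongr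
    _ = _ := by ring

lemma norm_le_one_of_orth {n d : ℕ} (U : Matrix (Fin n) (Fin d) ℝ) (hU : Uᵀ * U = 1) : ‖U‖ ≤ 1 := by
  have h := Matrix.l2_opNorm_conjTranspose_mul_self U
  rw [Matrix.conjTranspose_eq_transpose_of_trivial, hU] at h
  have h1 : ‖(1 : Matrix (Fin d) (Fin d) ℝ)‖ ≤ 1 := by
    rw [← Matrix.diagonal_one, Matrix.l2_opNorm_diagonal]
    refine (pi_norm_le_iff_of_nonneg zero_le_one).2 fun i => by simp
  nlinarith [norm_nonneg U]

lemma spec_thm_real {n : ℕ} (E : Matrix (Fin n) (Fin n) ℝ) (hE : E.IsHermitian) :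
    ∃ V : Matrix (Fin n) (Fin n) ℝ, Vᵀ * V = 1 ∧ V * Vᵀ = 1 ∧
      E = V * diagonal hE.eigenvalues * Vᵀ := by
  refine ⟨hE.eigenvectorUnitary, ?_, ?_, ?_⟩
  · exact Unitary.coe_star_mul_self hE.eigenvectorUnitary
  · exact Unitary.coe_mul_star_self hE.eigenvectorUnitary
  · conv_lhs => rw [hE.spectral_theorem]
    rfl

lemma hermitian_norm_le {n : ℕ} (E : Matrix (Fin n) (Fin n) ℝ) (hE : E.IsHermitian) {c : ℝ}
    (hc : 0 ≤ c) (h : ∀ i, |hE.eigenvalues i| ≤ c) : ‖E‖ ≤ c := by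
  obtain ⟨V, h1, h2, h3⟩ := spec_thm_real E hE
  have hV := norm_le_one_of_orth V h1
  have hV' := norm_le_one_of_orth Vᵀ (by simpa using h2)
  have hd : ‖(diagonal hE.eigenvalues : Matrix (Fin n) (Fin n) ℝ)‖ ≤ c := by
    rw [Matrix.l2_opNorm_diagonal]
    exact (pi_norm_le_iff_of_nonneg hc).2 fun i => h i
  rw [h3]
  calc _ ≤ ‖V‖ * ‖(diagonal hE.eigenvalues : Matrix (Fin n) (Fin n) ℝ)‖ * ‖Vᵀ‖ :=
        (Matrix.l2_opNorm_mul _ _).trans (by gcongr; exact Matrix.l2_opNorm_mul _ _)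
    _ ≤ 1 * c * 1 := by gcongr
    _ = c := by ring

lemma eig_abs_le {n : ℕ} (E : Matrix (Fin n) (Fin n) ℝ) (hE : E.IsHermitian) (i : Fin n) :
    |hE.eigenvalues i| ≤ ‖E‖ := by
  have h := opn_abs E (hE.eigenvectorBasis i)
  rw [hE.mulVec_eigenvectorBasis] at h
  have h1 : (hE.eigenvectorBasis i : Fin n → ℝ) ⬝ᵥ (hE.eigenvectorBasis i : Fin n → ℝ) = 1 := by
    have := hE.eigenvectorBasis.orthonormal.1 i
    have h2 := EuclideanSpace.norm_sq_eq (hE.eigenvectorBasis i)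
    rw [this] at h2
    simp only [dotProduct, ← sq]
    simpa [sq_abs] using h2.symm
  rw [dotProduct_smul, h1] at h
  simpa using h

lemma frob_le {n r : ℕ} (E : Matrix (Fin n) (Fin n) ℝ) (hE : E.IsHermitian) {c : ℝ}
    (hr : E.rank ≤ r) (hc : ‖E‖ ≤ c) : ∑ i, ∑ j, E i j ^ 2 ≤ r * c ^ 2 := by
  have h1 : ∑ i, ∑ j, E i j ^ 2 = ∑ i, hE.eigenvalues i ^ 2 := by
    have e1 : ∑ i, ∑ j, E i j ^ 2 = (E * Eᵀ).trace := by
      simp [Matrix.trace, Matrix.mul_apply, sq]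
    have e2 : Eᵀ = E := by
      have := hE.eq; rwa [Matrix.conjTranspose_eq_transpose_of_trivial] at this
    obtain ⟨V, v1, v2, v3⟩ := spec_thm_real E hE
    rw [e1, e2]
    generalize hE.eigenvalues = ev at *
    have : E * E = V * (diagonal ev * diagonal ev * Vᵀ) := by
      rw [v3]
      calc _ = V * diagonal ev * (Vᵀ * V) * diagonal ev * Vᵀ := by simp only [Matrix.mul_assoc]
        _ = _ := by rw [v1]; simp only [Matrix.mul_assoc, Matrix.mul_one]
    rw [this, Matrix.trace_mul_comm, Matrix.mul_assoc, v1, Matrix.mul_one, Matrix.diagonal_mul_diagonal,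
      Matrix.trace_diagonal]
    simp [sq]
  rw [h1]
  have h2 : ∀ i, hE.eigenvalues i ^ 2 ≤ if hE.eigenvalues i ≠ 0 then c ^ 2 else 0 := by
    intro i
    split_ifs with h
    · have := (eig_abs_le E hE i).trans hc
      exact sq_le_sq' (by linarith [neg_abs_le (hE.eigenvalues i)]) ((le_abs_self _).trans this)
    · push Not at h; simp [h]
  refine (Finset.sum_le_sum fun i _ => h2 i).trans ?_
  rw [← Finset.sum_filter, Finset.sum_const, nsmul_eq_mul]
  have h3 := hE.rank_eq_card_non_zero_eigs
  rw [Fintype.card_subtype] at h3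
  rw [← h3]
  gcongr

end

section

open scoped Matrix.Norms.L2Operator

lemma ase_frob {n d : ℕ} (A : Fin n → Fin n → ℝ) (hA : ∀ i j, A i j = A j i)
    (X Xh : Fin n → Fin d → ℝ) (hX : IsASE A Xh) :
    ∑ i, ∑ j, (dotd (Xh i) (Xh j) - dotd (X i) (X j)) ^ 2 ≤
      (2 * d : ℕ) * (4 * ‖Matrix.of A - Matrix.of X * (Matrix.of X)ᵀ‖) ^ 2 := by
  obtain ⟨lam, U', hU, hAU, hmax, hXh⟩ := hX
  set A' : Matrix (Fin n) (Fin n) ℝ := Matrix.of A with hA'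
  set X' : Matrix (Fin n) (Fin d) ℝ := Matrix.of X with hX'
  set U : Matrix (Fin n) (Fin d) ℝ := Matrix.of U' with hUdef
  set M := A' - X' * X'ᵀ with hM
  set m := ‖M‖ with hm
  have hm0 : 0 ≤ m := norm_nonneg _
  have hUU : Uᵀ * U = 1 := by
    ext j j'
    simp only [Matrix.mul_apply, Matrix.transpose_apply, Matrix.one_apply, hUdef, Matrix.of_apply]
    exact hU j j'
  have hAT : A'ᵀ = A' := by ext i j; simp [hA', hA i j]
  have hAU' : A' * U = U * diagonal lam := by
    ext i j
    have := congrFun (hAU j) i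
    simp only [Matrix.mulVec, dotProduct] at this
    rw [Matrix.mul_diagonal, Matrix.mul_apply]
    simp only [hUdef, Matrix.of_apply]
    rw [this]; ring
  have hMw : ∀ w, X'ᵀ *ᵥ w = 0 → M *ᵥ w = A' *ᵥ w := by
    intro w hw
    rw [hM, Matrix.sub_mulVec, ← Matrix.mulVec_mulVec, hw, Matrix.mulVec_zero, sub_zero]
  set Ad := U * diagonal lam * Uᵀ with hAd
  set E := A' - Ad with hE
  have hEU : E * U = 0 := by
    rw [hE, Matrix.sub_mul, hAU', hAd, Matrix.mul_assoc, hUU, Matrix.mul_one, sub_self]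
  have hAdT : Adᵀ = Ad := by
    rw [hAd, Matrix.transpose_mul, Matrix.transpose_mul, Matrix.transpose_transpose,
      Matrix.diagonal_transpose, Matrix.mul_assoc]
  have hET : Eᵀ = E := by rw [hE, Matrix.transpose_sub, hAT, hAdT]
  have hEH : E.IsHermitian := by
    rw [Matrix.IsHermitian, Matrix.conjTranspose_eq_transpose_of_trivial, hET]
  have hEn : ‖E‖ ≤ m := by
    refine hermitian_norm_le E hEH hm0 fun i => ?_
    set mu := hEH.eigenvalues i
    by_cases hmu : mu = 0
    · rw [hmu]; simpa using hm0
    set v : Fin n → ℝ := (hEH.eigenvectorBasis i).ofLp with hv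
    have hEv : E *ᵥ v = mu • v := hEH.mulVec_eigenvectorBasis i
    have hvv : v ⬝ᵥ v = 1 := by
      have := hEH.eigenvectorBasis.orthonormal.1 i
      have h2 := EuclideanSpace.norm_sq_eq (hEH.eigenvectorBasis i)
      rw [this] at h2
      simp only [dotProduct, ← sq]
      simpa [sq_abs] using h2.symm
    have hUv : Uᵀ *ᵥ v = 0 := by
      have h1 : mu • (Uᵀ *ᵥ v) = 0 := by
        rw [← Matrix.mulVec_smul, ← hEv, Matrix.mulVec_mulVec, ← hET, ← Matrix.transpose_mul, hEU]
        simp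
      exact (smul_eq_zero.1 h1).resolve_left hmu
    have hAv : A' *ᵥ v = mu • v := by
      have : A' = E + Ad := by rw [hE]; abel
      rw [this, Matrix.add_mulVec, hEv, hAd, ← Matrix.mulVec_mulVec, hUv, Matrix.mulVec_zero, add_zero]
    have hv0 : v ≠ 0 := by rintro h; rw [h] at hvv; simp at hvv
    have hle : ∀ j, |mu| ≤ |lam j| := by
      refine hmax mu v hv0 hAv fun j => ?_
      have := congrFun hUv j
      simp only [Matrix.mulVec, dotProduct, Matrix.transpose_apply, hUdef, Matrix.of_apply,
        Pi.zero_apply] at this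
      rw [← this]; exact Finset.sum_congr rfl fun i _ => mul_comm _ _
    let f : (ℝ × (Fin d → ℝ)) →ₗ[ℝ] (Fin d → ℝ) :=
      (Matrix.mulVecLin X'ᵀ) ∘ₗ ((LinearMap.toSpanSingleton ℝ _ v).coprod (Matrix.mulVecLin U))
    have hker : LinearMap.ker f ≠ ⊥ := by
      apply LinearMap.ker_ne_bot_of_finrank_lt
      simp
    obtain ⟨⟨c0, c⟩, hc, hc0⟩ := (Submodule.ne_bot_iff _).1 hker
    set w := c0 • v + U *ᵥ c with hw
    have hXw : X'ᵀ *ᵥ w = 0 := by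
      have h' : f (c0, c) = 0 := hc
      rw [← h', hw]; rfl
    have cross : ∀ (s t : ℝ) (y : Fin d → ℝ),
        (s • v + U *ᵥ y) ⬝ᵥ (s • v + U *ᵥ y) = s ^ 2 + y ⬝ᵥ y := by
      intro s t y
      have e1 : v ⬝ᵥ (U *ᵥ y) = 0 := by
        rw [Matrix.dotProduct_mulVec, ← Matrix.mulVec_transpose, hUv, zero_dotProduct]
      have e2 : (U *ᵥ y) ⬝ᵥ v = 0 := by rw [dotProduct_comm, e1]
      have e3 : (U *ᵥ y) ⬝ᵥ (U *ᵥ y) = y ⬝ᵥ y := by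
        rw [Matrix.dotProduct_mulVec, Matrix.vecMul_mulVec, ← Matrix.mulVec_transpose,
          Matrix.transpose_mul, Matrix.transpose_transpose, hUU, Matrix.one_mulVec]
      simp only [add_dotProduct, dotProduct_add, smul_dotProduct, dotProduct_smul, e1, e2, e3, hvv]
      simp; ring
    have hww := cross c0 0 c
    have hAw : A' *ᵥ w = (c0 * mu) • v + U *ᵥ (fun j => lam j * c j) := by
      rw [hw, Matrix.mulVec_add, Matrix.mulVec_smul, hAv, smul_smul, Matrix.mulVec_mulVec, hAU',
        ← Matrix.mulVec_mulVec]
      congr 2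
      ext j; simp [Matrix.mulVec_diagonal]
    have hAww := cross (c0 * mu) 0 (fun j => lam j * c j)
    rw [← hAw] at hAww
    have h1 := opn_sq M w
    rw [hMw w hXw, hAww, hw, hww] at h1
    have h2 : mu ^ 2 * (c ⬝ᵥ c) ≤ (fun j => lam j * c j) ⬝ᵥ (fun j => lam j * c j) := by
      simp only [dotProduct, Finset.mul_sum]
      refine Finset.sum_le_sum fun j _ => ?_
      have : mu ^ 2 ≤ lam j ^ 2 := sq_le_sq.2 (hle j)
      nlinarith [mul_self_nonneg (c j)]
    have hpos : 0 < c0 ^ 2 + c ⬝ᵥ c := by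
      have hn : 0 ≤ c ⬝ᵥ c := by
        simp only [dotProduct]; exact Finset.sum_nonneg fun i _ => mul_self_nonneg _
      rcases (sq_nonneg c0).lt_or_eq with h | h
      · linarith
      · rcases hn.lt_or_eq with h' | h'
        · linarith
        · exfalso; apply hc0
          have : c = 0 := dotProduct_self_eq_zero.1 h'.symm
          have h0 : c0 = 0 := by simpa using h.symm
          rw [this, h0]; rfl
    apply abs_le_of_sq_le_sq _ hm0
    have h3 : mu ^ 2 * (c0 ^ 2 + c ⬝ᵥ c) ≤ m ^ 2 * (c0 ^ 2 + c ⬝ᵥ c) := by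
      nlinarith
    exact le_of_mul_le_mul_right h3 hpos
  have hneg : ∀ j, |(|lam j| - lam j)| ≤ 2 * m := by
    intro j
    rcases le_or_gt 0 (lam j) with h | h
    · rw [abs_of_nonneg h]; simpa using hm0
    · set u : Fin n → ℝ := fun i => U' i j with hu
      have huu : u ⬝ᵥ u = 1 := by simpa [dotProduct] using hU j j
      have h1 := opn_abs M u
      have h2 : u ⬝ᵥ (M *ᵥ u) = lam j - (X'ᵀ *ᵥ u) ⬝ᵥ (X'ᵀ *ᵥ u) := by
        rw [hM, Matrix.sub_mulVec, dotProduct_sub, ← Matrix.mulVec_mulVec,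
          Matrix.dotProduct_mulVec u X', ← Matrix.mulVec_transpose]
        congr 1
        have : A' *ᵥ u = lam j • u := by rw [hA', hu, hAU j]; rfl
        rw [this, dotProduct_smul, huu]; simp
      rw [huu, h2, mul_one] at h1
      have h3 : 0 ≤ (X'ᵀ *ᵥ u) ⬝ᵥ (X'ᵀ *ᵥ u) := by
        simp only [dotProduct]; exact Finset.sum_nonneg fun i _ => mul_self_nonneg _
      have h4 := (abs_le.1 h1).1
      rw [abs_of_neg h, abs_of_nonneg (by linarith)]
      linarith
  set Aa := U * diagonal (fun j => |lam j|) * Uᵀ with hAa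
  have hdiff : Aa - Ad = U * diagonal (fun j => |lam j| - lam j) * Uᵀ := by
    rw [hAa, hAd, ← Matrix.sub_mul, ← Matrix.mul_sub, Matrix.diagonal_sub]
  have hdn : ‖Aa - Ad‖ ≤ 2 * m := by
    have hU1 := norm_le_one_of_orth U hUU
    have hU2 : ‖Uᵀ‖ ≤ 1 := by
      rw [← Matrix.conjTranspose_eq_transpose_of_trivial, Matrix.l2_opNorm_conjTranspose]; exact hU1
    have hd : ‖(diagonal (fun j => |lam j| - lam j) : Matrix (Fin d) (Fin d) ℝ)‖ ≤ 2 * m := by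
      rw [Matrix.l2_opNorm_diagonal]
      exact (pi_norm_le_iff_of_nonneg (by linarith)).2 fun i => hneg i
    rw [hdiff]
    calc _ ≤ ‖U‖ * ‖(diagonal (fun j => |lam j| - lam j) : Matrix (Fin d) (Fin d) ℝ)‖ * ‖Uᵀ‖ :=
          (Matrix.l2_opNorm_mul _ _).trans (by gcongr; exact Matrix.l2_opNorm_mul _ _)
      _ ≤ 1 * (2 * m) * 1 := by gcongr
      _ = 2 * m := by ring
  set D := Aa - X' * X'ᵀ with hD
  have hDn : ‖D‖ ≤ 4 * m := by
    have : D = (Aa - Ad) + (M - E) := by rw [hD, hM, hE]; abel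
    rw [this]
    have h1 := norm_add_le (Aa - Ad) (M - E)
    have h2 := norm_sub_le M E
    linarith
  have hDH : D.IsHermitian := by
    rw [Matrix.IsHermitian, Matrix.conjTranspose_eq_transpose_of_trivial, hD, Matrix.transpose_sub,
      hAa]
    simp [Matrix.transpose_mul, Matrix.mul_assoc]
  have hDr : D.rank ≤ 2 * d := by
    have : D = Matrix.fromCols (U * diagonal (fun j => |lam j|)) X' * Matrix.fromRows Uᵀ (-X'ᵀ) := by
      rw [Matrix.fromCols_mul_fromRows, hD, hAa, Matrix.mul_neg, sub_eq_add_neg]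
    rw [this]
    refine (Matrix.rank_mul_le_left _ _).trans ((Matrix.rank_le_card_width _).trans ?_)
    simp; omega
  have hfin := frob_le D hDH hDr hDn
  refine le_trans (le_of_eq ?_) hfin
  refine Finset.sum_congr rfl fun i _ => Finset.sum_congr rfl fun j _ => ?_
  congr 1
  rw [hD, Matrix.sub_apply, hAa]
  rw [Matrix.mul_apply]
  simp only [Matrix.mul_diagonal]
  simp only [dotd, Matrix.mul_apply, Matrix.transpose_apply, hXh, hUdef, hX', Matrix.of_apply]
  congr 1
  refine Finset.sum_congr rfl fun k _ => ?_
  have := Real.mul_self_sqrt (abs_nonneg (lam k))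
  linear_combination (U' i k * U' j k) * this

lemma exists_ase {n d : ℕ} (hdn : d ≤ n) (A : Fin n → Fin n → ℝ) (hA : ∀ i j, A i j = A j i) :
    ∃ Xh : Fin n → Fin d → ℝ, IsASE A Xh := by
  have hH : (Matrix.of A).IsHermitian := by
    rw [Matrix.IsHermitian, Matrix.conjTranspose_eq_transpose_of_trivial]
    ext i j; simp [hA i j]
  set ev := hH.eigenvalues
  set b := hH.eigenvectorBasis
  have hb : ∀ i j, (b i : Fin n → ℝ) ⬝ᵥ (b j : Fin n → ℝ) = if i = j then 1 else 0 := by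
    intro i j
    have := orthonormal_iff_ite.1 b.orthonormal j i
    rw [EuclideanSpace.inner_eq_star_dotProduct] at this
    simp only [star_trivial] at this
    rw [this]; simp [eq_comm]
  let s := Tuple.sort (fun i => -|ev i|)
  have hs := Tuple.monotone_sort (fun i => -|ev i|)
  let e : Fin d → Fin n := fun j => s (Fin.castLE hdn j)
  have he : Function.Injective e := fun j j' h => by
    have := s.injective h
    exact Fin.castLE_injective hdn this
  refine ⟨_, fun j => ev (e j), fun i j => b (e j) i, ?_, ?_, ?_, fun i j => rfl⟩
  · intro j j'
    have := hb (e j) (e j')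
    simp only [dotProduct] at this
    rw [this]; simp [he.eq_iff]
  · intro j
    exact hH.mulVec_eigenvectorBasis (e j)
  · intro mu v hv hAv hort j
    have hex : ∃ i, (b i : Fin n → ℝ) ⬝ᵥ v ≠ 0 := by
      by_contra hcon
      push Not at hcon
      apply hv
      have : (WithLp.toLp 2 v : EuclideanSpace ℝ (Fin n)) = 0 := by
        apply b.repr.injective
        ext i
        rw [b.repr_apply_apply, EuclideanSpace.inner_eq_star_dotProduct]
        simpa [dotProduct_comm] using hcon i
      simpa using this
    obtain ⟨i, hi⟩ := hex
    have hmu : mu = ev i := by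
      have h1 : (b i : Fin n → ℝ) ⬝ᵥ ((Matrix.of A) *ᵥ v) = ev i * ((b i : Fin n → ℝ) ⬝ᵥ v) := by
        rw [Matrix.dotProduct_mulVec, ← Matrix.mulVec_transpose]
        have : (Matrix.of A)ᵀ = Matrix.of A := by ext i j; simp [hA i j]
        rw [this, hH.mulVec_eigenvectorBasis i, smul_dotProduct]; rfl
      rw [hAv, dotProduct_smul, smul_eq_mul] at h1
      exact mul_right_cancel₀ hi h1
    have hi' : ∀ j, i ≠ e j := by
      rintro j rfl
      apply hi
      rw [← hort j]
      simp only [dotProduct]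
      exact Finset.sum_congr rfl fun i _ => mul_comm _ _
    rw [hmu]
    have hle : Fin.castLE hdn j ≤ s.symm i := by
      rw [Fin.le_def]
      by_contra hcon
      push Not at hcon
      have hlt : (s.symm i).val < d := lt_of_lt_of_le hcon (by simp)
      apply hi' ⟨(s.symm i).val, hlt⟩
      simp [e]
    have := hs hle
    simp only [Function.comp, s, Equiv.apply_symm_apply] at this
    simpa [e, s] using this

lemma ase_isASE {n d : ℕ} (hdn : d ≤ n) (A : Fin n → Fin n → ℝ) (hA : ∀ i j, A i j = A j i) :
    IsASE A (ase d A) := by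
  have h := exists_ase hdn A hA
  rw [ase, dif_pos h]
  exact h.choose_spec

end

section

open scoped Matrix.Norms.L2Operator

lemma sum_exp_int (K : ℕ) : ∑ k ∈ Finset.Icc (-(K:ℤ)) K, Real.exp (-((k:ℝ)^2)) ≤ Real.exp 2 := by
  have hsub : Finset.Icc (-(K:ℤ)) K ⊆ (Finset.range (K+1)).image (fun j : ℕ => (j:ℤ)) ∪
      (Finset.range (K+1)).image (fun j : ℕ => -(j:ℤ)) := by
    intro k hk
    simp only [Finset.mem_Icc, Finset.mem_union, Finset.mem_image, Finset.mem_range] at hk ⊢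
    rcases le_total 0 k with h | h
    · left; exact ⟨k.toNat, by omega, by omega⟩
    · right; exact ⟨(-k).toNat, by omega, by omega⟩
  have hgeo : ∑ j ∈ Finset.range (K+1), Real.exp (-((j:ℝ)^2)) ≤ 2 := by
    calc ∑ j ∈ Finset.range (K+1), Real.exp (-((j:ℝ)^2))
        ≤ ∑ j ∈ Finset.range (K+1), ((1:ℝ)/2)^j := by
          refine Finset.sum_le_sum fun j _ => ?_
          have h1 : Real.exp (-1) ≤ 1/2 := by
            rw [Real.exp_neg, ← one_div]
            apply one_div_le_one_div_of_le (by norm_num)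
            linarith [Real.add_one_le_exp (1:ℝ)]
          calc Real.exp (-((j:ℝ)^2)) ≤ Real.exp (j * (-1)) := by
                apply Real.exp_le_exp.2
                have : (j:ℝ) ≤ (j:ℝ)^2 := by exact_mod_cast Nat.le_self_pow (by norm_num) j
                linarith
            _ = Real.exp (-1) ^ j := by rw [Real.exp_nat_mul]
            _ ≤ _ := by gcongr
      _ ≤ 2 := sum_geometric_two_le _
  have h4 : (4:ℝ) ≤ Real.exp 2 := by
    have h1 := Real.add_one_le_exp (1:ℝ)
    have : Real.exp 2 = Real.exp 1 * Real.exp 1 := by rw [← Real.exp_add]; norm_num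
    nlinarith
  calc _ ≤ ∑ k ∈ (Finset.range (K+1)).image (fun j : ℕ => (j:ℤ)) ∪
      (Finset.range (K+1)).image (fun j : ℕ => -(j:ℤ)), Real.exp (-((k:ℝ)^2)) :=
        Finset.sum_le_sum_of_subset_of_nonneg hsub fun _ _ _ => (Real.exp_pos _).le
    _ ≤ ∑ k ∈ (Finset.range (K+1)).image (fun j : ℕ => (j:ℤ)), Real.exp (-((k:ℝ)^2)) +
        ∑ k ∈ (Finset.range (K+1)).image (fun j : ℕ => -(j:ℤ)), Real.exp (-((k:ℝ)^2)) := by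
        rw [← Finset.sum_union_inter]
        exact le_add_of_nonneg_right (Finset.sum_nonneg fun _ _ => (Real.exp_pos _).le)
    _ ≤ 2 + 2 := by
        rw [Finset.sum_image (by intro a _ b _ h; simpa using h),
          Finset.sum_image (by intro a _ b _ h; simpa using h)]
        push_cast
        simp only [neg_sq]
        linarith
    _ ≤ _ := by linarith

lemma trunc_spec (y : ℝ) : ∃ k : ℤ, |(k:ℝ)| ≤ |y| ∧ |y - k| ≤ 1 := by
  rcases le_total 0 y with h | h
  · refine ⟨⌊y⌋, ?_, ?_⟩
    · have : (0:ℝ) ≤ ⌊y⌋ := by exact_mod_cast Int.floor_nonneg.2 h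
      rw [abs_of_nonneg this, abs_of_nonneg h]; exact Int.floor_le y
    · rw [abs_le]; constructor <;> linarith [Int.floor_le y, Int.lt_floor_add_one y]
  · refine ⟨⌈y⌉, ?_, ?_⟩
    · have : (⌈y⌉:ℝ) ≤ 0 := by
        have : ⌈y⌉ ≤ 0 := Int.ceil_le.2 (by simpa using h)
        exact_mod_cast this
      rw [abs_of_nonpos this, abs_of_nonpos h]; linarith [Int.le_ceil y]
    · rw [abs_le]; constructor <;> linarith [Int.le_ceil y, Int.ceil_lt_add_one y]

lemma exists_net (n : ℕ) (hn : 0 < n) : ∃ N : Finset (EuclideanSpace ℝ (Fin n)),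
    (N.card : ℝ) ≤ Real.exp (18 * n) ∧ (∀ z ∈ N, ‖z‖ ≤ 1) ∧
      ∀ x : EuclideanSpace ℝ (Fin n), ‖x‖ ≤ 1 → ∃ z ∈ N, ‖x - z‖ ≤ 1/4 := by
  have hn' : (1:ℝ) ≤ n := by exact_mod_cast hn
  set r : ℝ := 4 * Real.sqrt n with hr
  have hs : Real.sqrt n ^ 2 = n := Real.sq_sqrt (by positivity)
  have hr2 : r ^ 2 = 16 * n := by rw [hr, mul_pow, hs]; norm_num
  have hrpos : 0 < r := by positivity
  let box : Finset (Fin n → ℤ) := Fintype.piFinset (fun _ => Finset.Icc (-((4*n:ℕ):ℤ)) ((4*n:ℕ):ℤ))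
  let B := box.filter (fun z => ∑ i, ((z i:ℝ))^2 ≤ 16 * n)
  let f : (Fin n → ℤ) → EuclideanSpace ℝ (Fin n) := fun z => WithLp.toLp 2 (fun i => (z i : ℝ) / r)
  refine ⟨B.image f, ?_, ?_, ?_⟩
  · have h1 : ((B.image f).card : ℝ) ≤ B.card := by exact_mod_cast Finset.card_image_le
    refine h1.trans ?_
    calc (B.card : ℝ) = ∑ z ∈ B, 1 := by simp
      _ ≤ ∑ z ∈ B, Real.exp (16 * n) * Real.exp (-∑ i, ((z i:ℝ))^2) := by
          refine Finset.sum_le_sum fun z hz => ?_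
          rw [← Real.exp_add]
          apply Real.one_le_exp
          have := (Finset.mem_filter.1 hz).2
          linarith
      _ ≤ ∑ z ∈ box, Real.exp (16 * n) * Real.exp (-∑ i, ((z i:ℝ))^2) :=
          Finset.sum_le_sum_of_subset_of_nonneg (Finset.filter_subset _ _) fun _ _ _ => by positivity
      _ = Real.exp (16 * n) * ∏ _i : Fin n, ∑ k ∈ Finset.Icc (-((4*n:ℕ):ℤ)) ((4*n:ℕ):ℤ),
            Real.exp (-((k:ℝ)^2)) := by
          rw [← Finset.mul_sum, Finset.prod_univ_sum]
          congr 1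
          refine Finset.sum_congr rfl fun z _ => ?_
          rw [← Real.exp_sum, Finset.sum_neg_distrib]
      _ ≤ Real.exp (16 * n) * ∏ _i : Fin n, Real.exp 2 := by
          gcongr with i
          exact sum_exp_int _
      _ = Real.exp (18 * n) := by
          rw [Finset.prod_const, Finset.card_univ, Fintype.card_fin, ← Real.exp_nat_mul,
            ← Real.exp_add]
          congr 1; ring
  · intro z hz
    obtain ⟨y, hy, rfl⟩ := Finset.mem_image.1 hz
    have hy2 := (Finset.mem_filter.1 hy).2
    rw [← sq_le_one_iff₀ (norm_nonneg _), EuclideanSpace.norm_sq_eq]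
    have : ∑ i, ‖(f y) i‖ ^ 2 = (∑ i, ((y i:ℝ))^2) / r ^ 2 := by
      rw [Finset.sum_div]
      refine Finset.sum_congr rfl fun i _ => ?_
      simp [f, div_pow, sq_abs]
    rw [this, hr2]
    exact div_le_one_of_le₀ hy2 (by positivity)
  · intro x hx
    choose z hz1 hz2 using fun i => trunc_spec (r * x i)
    have hxs : ∑ i, (x i) ^ 2 ≤ 1 := by
      have := EuclideanSpace.norm_sq_eq x
      simp only [Real.norm_eq_abs, sq_abs] at this
      rw [← this]; exact pow_le_one₀ (norm_nonneg _) hx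
    have hzs : ∑ i, ((z i:ℝ))^2 ≤ 16 * n := by
      calc ∑ i, ((z i:ℝ))^2 ≤ ∑ i, (r * x i)^2 :=
            Finset.sum_le_sum fun i _ => sq_le_sq.2 (hz1 i)
        _ = r^2 * ∑ i, (x i)^2 := by simp only [mul_pow, Finset.mul_sum]
        _ ≤ r^2 * 1 := by gcongr
        _ = _ := by rw [hr2, mul_one]
    refine ⟨f z, Finset.mem_image_of_mem _ (Finset.mem_filter.2 ⟨?_, hzs⟩), ?_⟩
    · refine Fintype.mem_piFinset.2 fun i => ?_
      have h1 : ((z i:ℝ))^2 ≤ 16 * n :=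
        (Finset.single_le_sum (fun j _ => sq_nonneg ((z j:ℝ))) (Finset.mem_univ i)).trans hzs
      have h2 : |(z i : ℝ)| ≤ 4 * n := by
        apply abs_le_of_sq_le_sq _ (by positivity)
        nlinarith
      rw [abs_le] at h2
      rw [Finset.mem_Icc]
      constructor
      · have := h2.1; push_cast; exact_mod_cast this
      · have := h2.2; push_cast; exact_mod_cast this
    · apply le_of_sq_le_sq _ (by norm_num)
      rw [EuclideanSpace.norm_sq_eq]
      calc ∑ i, ‖(x - f z) i‖ ^ 2 ≤ ∑ _i : Fin n, 1 / r ^ 2 := by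
            refine Finset.sum_le_sum fun i _ => ?_
            have : (x - f z) i = (r * x i - z i) / r := by
              simp only [f, PiLp.sub_apply]; field_simp
            rw [this, norm_div, div_pow, Real.norm_eq_abs, Real.norm_eq_abs, sq_abs r]
            gcongr
            exact pow_le_one₀ (abs_nonneg _) (hz2 i)
        _ = (1/4)^2 := by
            rw [Finset.sum_const, Finset.card_univ, Fintype.card_fin, nsmul_eq_mul, hr2]
            field_simp; norm_num

lemma exp_norm_le {n : ℕ} (N : Finset (EuclideanSpace ℝ (Fin n)))
    (hN1 : ∀ z ∈ N, ‖z‖ ≤ 1)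
    (hN2 : ∀ x : EuclideanSpace ℝ (Fin n), ‖x‖ ≤ 1 → ∃ z ∈ N, ‖x - z‖ ≤ 1/4)
    (M : Matrix (Fin n) (Fin n) ℝ) {t : ℝ} (ht : 0 < t) :
    Real.exp (t * ‖M‖ / 2) ≤ ∑ z ∈ N, ∑ w ∈ N, Real.exp (t * ((z : Fin n → ℝ) ⬝ᵥ (M *ᵥ (w : Fin n → ℝ)))) := by
  set S := ∑ z ∈ N, ∑ w ∈ N, Real.exp (t * ((z : Fin n → ℝ) ⬝ᵥ (M *ᵥ (w : Fin n → ℝ)))) with hS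
  set T := toEuclideanCLM (n := Fin n) (𝕜 := ℝ) M with hT
  have hTM : ‖T‖ = ‖M‖ := Matrix.l2_opNorm_toEuclideanCLM M
  have hin : ∀ z w : EuclideanSpace ℝ (Fin n), inner ℝ z (T w) = (z : Fin n → ℝ) ⬝ᵥ (M *ᵥ (w : Fin n → ℝ)) := by
    intro z w
    rw [EuclideanSpace.inner_eq_star_dotProduct]
    simp [hT, dotProduct_comm]
  have hle : ∀ z ∈ N, ∀ w ∈ N, Real.exp (t * ((z : Fin n → ℝ) ⬝ᵥ (M *ᵥ (w : Fin n → ℝ)))) ≤ S := by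
    intro z hz w hw
    refine le_trans ?_ (Finset.single_le_sum (f := fun z : EuclideanSpace ℝ (Fin n) => ∑ w ∈ N, Real.exp (t * ((z : Fin n → ℝ) ⬝ᵥ (M *ᵥ (w : Fin n → ℝ)))))
      (fun z _ => Finset.sum_nonneg fun w _ => (Real.exp_pos _).le) hz)
    exact Finset.single_le_sum (f := fun w : EuclideanSpace ℝ (Fin n) => Real.exp (t * ((z : Fin n → ℝ) ⬝ᵥ (M *ᵥ (w : Fin n → ℝ)))))
      (fun w _ => (Real.exp_pos _).le) hw
  obtain ⟨z0, hz0, -⟩ := hN2 0 (by simp)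
  have hSpos : 0 < S := (Real.exp_pos _).trans_le (hle z0 hz0 z0 hz0)
  have hS1 : 0 ≤ Real.log S + t * (‖T‖ / 2) := by
    obtain ⟨z, hz, hzz⟩ := hN2 0 (by simp)
    have h1 := (Real.le_log_iff_exp_le hSpos).2 (hle z hz z hz)
    rw [← hin] at h1
    have h2 : |inner ℝ z (T z)| ≤ ‖T‖ / 2 := by
      refine (abs_real_inner_le_norm _ _).trans ?_
      have h3 := T.le_opNorm z
      have h4 : ‖z‖ ≤ 1/4 := by simpa using hzz
      have h5 := norm_nonneg z
      have h6 := norm_nonneg T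
      calc ‖z‖ * ‖T z‖ ≤ 1 * (‖T‖ * (1/2)) := by
            gcongr
            · linarith
            · exact h3.trans (by gcongr; linarith)
        _ = _ := by ring
    have h3 := (abs_le.1 h2).1
    nlinarith
  have hB : ‖T‖ ≤ Real.log S / t + ‖T‖ / 2 := by
    have hB0 : 0 ≤ Real.log S / t + ‖T‖ / 2 := by
      have : Real.log S / t + ‖T‖ / 2 = (Real.log S + t * (‖T‖ / 2)) / t := by field_simp
      rw [this]; positivity
    have hbil : ∀ x y : EuclideanSpace ℝ (Fin n), ‖x‖ ≤ 1 → ‖y‖ ≤ 1 →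
        inner ℝ x (T y) ≤ Real.log S / t + ‖T‖ / 2 := by
      intro x y hx hy
      obtain ⟨z, hz, hxz⟩ := hN2 x hx
      obtain ⟨w, hw, hyw⟩ := hN2 y hy
      have e : inner ℝ x (T y) = inner ℝ z (T w) + inner ℝ (x - z) (T y) + inner ℝ z (T (y - w)) := by
        simp only [inner_sub_left, map_sub, inner_sub_right]; ring
      have b1 : inner ℝ z (T w) ≤ Real.log S / t := by
        rw [le_div_iff₀ ht, hin, mul_comm]
        exact (Real.le_log_iff_exp_le hSpos).2 (hle z hz w hw)
      have b2 : inner ℝ (x - z) (T y) ≤ 1/4 * (‖T‖ * 1) := by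
        refine (real_inner_le_norm _ _).trans ?_
        gcongr
        exact (T.le_opNorm y).trans (by gcongr)
      have b3 : inner ℝ z (T (y - w)) ≤ 1 * (‖T‖ * (1/4)) := by
        refine (real_inner_le_norm _ _).trans ?_
        gcongr
        · exact hN1 z hz
        · exact (T.le_opNorm _).trans (by gcongr)
      rw [e]; linarith
    refine T.opNorm_le_of_unit_norm hB0 fun y hy => ?_
    by_cases h0 : ‖T y‖ = 0
    · rw [h0]; exact hB0
    · have := hbil ((‖T y‖)⁻¹ • T y) y (by rw [norm_smul, norm_inv, norm_norm, inv_mul_cancel₀ h0]) hy.le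
      rw [real_inner_smul_left, real_inner_self_eq_norm_sq, sq, ← mul_assoc, inv_mul_cancel₀ h0,
        one_mul] at this
      exact this
  rw [← Real.le_log_iff_exp_le hSpos, ← hTM]
  have : ‖T‖ / 2 ≤ Real.log S / t := by linarith
  rw [le_div_iff₀ ht] at this
  linarith

end

section

open scoped Matrix.Norms.L2Operator

instance unif_prob : IsProbabilityMeasure ((volume : Measure ℝ).restrict (Set.Icc (0:ℝ) 1)) :=
  ⟨by simp⟩

instance pairUniform_prob (n : ℕ) : IsProbabilityMeasure (pairUniform n) := by
  unfold pairUniform; infer_instance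

lemma unif_lt (p : ℝ) (h0 : 0 ≤ p) (h1 : p ≤ 1) :
    ∫ x, (if x < p then (1:ℝ) else 0) ∂((volume : Measure ℝ).restrict (Set.Icc (0:ℝ) 1)) = p := by
  have : (fun x : ℝ => if x < p then (1:ℝ) else 0) = (Set.Iio p).indicator (fun _ => (1:ℝ)) := by
    ext x; simp [Set.indicator]
  rw [this, integral_indicator_const _ measurableSet_Iio]
  have h2 : Set.Iio p ∩ Set.Icc 0 1 = Set.Ico 0 p := by
    ext x; simp only [Set.mem_inter_iff, Set.mem_Iio, Set.mem_Icc, Set.mem_Ico]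
    constructor
    · rintro ⟨a, b, c⟩; exact ⟨b, a⟩
    · rintro ⟨a, b⟩; exact ⟨b, a, by linarith⟩
  rw [measureReal_restrict_apply measurableSet_Iio, h2]
  simp [h0]

lemma mgf_unif (p : ℝ) (h0 : 0 ≤ p) (h1 : p ≤ 1) (s : ℝ) :
    Integrable (fun x => Real.exp (s * ((if x < p then (1:ℝ) else 0) - p)))
      ((volume : Measure ℝ).restrict (Set.Icc (0:ℝ) 1)) ∧
    ∫ x, Real.exp (s * ((if x < p then (1:ℝ) else 0) - p))
      ∂((volume : Measure ℝ).restrict (Set.Icc (0:ℝ) 1)) ≤ Real.exp (s ^ 2 / 8) := by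
  have hm : Measurable (fun x : ℝ => if x < p then (1:ℝ) else 0) :=
    Measurable.ite measurableSet_Iio measurable_const measurable_const
  have := ProbabilityTheory.hasSubgaussianMGF_of_mem_Icc (a := 0) (b := 1)
    (μ := (volume : Measure ℝ).restrict (Set.Icc (0:ℝ) 1)) hm.aemeasurable
    (Filter.Eventually.of_forall fun x => by split_ifs <;> simp)
  rw [unif_lt p h0 h1] at this
  refine ⟨this.integrable_exp_mul s, (this.mgf_le s).trans (le_of_eq ?_)⟩
  congr 1
  simp
  ring

lemma quad_expand {n d : ℕ} (X : Fin n → Fin d → ℝ) (u : Fin n × Fin n → ℝ) (z w : Fin n → ℝ)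
    (hX : ∀ i, |dotd (X i) (X i)| ≤ 1) (hz : ∑ i, z i ^ 2 ≤ 1) (hw : ∑ i, w i ^ 2 ≤ 1) :
    z ⬝ᵥ ((Matrix.of (adjOf 1 X u) - Matrix.of X * (Matrix.of X)ᵀ) *ᵥ w) ≤
      1 + ∑ q : Fin n × Fin n, (if q.1 < q.2 then z q.1 * w q.2 + z q.2 * w q.1 else 0) *
        ((if u q < dotd (X q.1) (X q.2) then (1:ℝ) else 0) - dotd (X q.1) (X q.2)) := by
  have hsym : ∀ i j, dotd (X i) (X j) = dotd (X j) (X i) := by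
    intro i j; simp [dotd, mul_comm]
  set g : Fin n → Fin n → ℝ := fun i j =>
    ((if u (i, j) < dotd (X i) (X j) then (1:ℝ) else 0) - dotd (X i) (X j)) with hg
  have hM : ∀ i j, (Matrix.of (adjOf 1 X u) - Matrix.of X * (Matrix.of X)ᵀ) i j =
      (if i = j then - dotd (X i) (X i) else 0) + (if i < j then g i j else 0) +
        (if j < i then g j i else 0) := by
    intro i j
    simp only [Matrix.sub_apply, Matrix.of_apply, Matrix.mul_apply, Matrix.transpose_apply, adjOf,
      one_mul]
    change _ - dotd (X i) (X j) = _
    rcases lt_trichotomy i j with h | h | h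
    · simp [h, h.ne, h.not_gt, hg, h.le]
    · subst h; simp
    · simp [h, h.ne', h.not_gt, hg, h.le, hsym i j]
  have e1 : z ⬝ᵥ ((Matrix.of (adjOf 1 X u) - Matrix.of X * (Matrix.of X)ᵀ) *ᵥ w) =
      (∑ i, - (z i * dotd (X i) (X i) * w i)) +
      (∑ i, ∑ j, if i < j then z i * g i j * w j else 0) +
      (∑ i, ∑ j, if j < i then z i * g j i * w j else 0) := by
    simp only [dotProduct, mulVec, Finset.mul_sum, hM, ← Finset.sum_add_distrib]
    refine Finset.sum_congr rfl fun i _ => ?_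
    have : - (z i * dotd (X i) (X i) * w i) =
        ∑ j, if i = j then - (z i * dotd (X i) (X i) * w i) else 0 := by simp
    rw [this, ← Finset.sum_add_distrib, ← Finset.sum_add_distrib]
    refine Finset.sum_congr rfl fun j _ => ?_
    rcases lt_trichotomy i j with h | h | h
    · simp [h, h.ne, h.not_gt]; ring
    · subst h; simp; ring
    · simp [h, h.ne', h.not_gt]; ring
  rw [e1]
  have e2 : (∑ i, ∑ j, if j < i then z i * g j i * w j else 0) =
      ∑ i, ∑ j, if i < j then z j * g i j * w i else 0 := Finset.sum_comm
  have e3 : ∑ q : Fin n × Fin n, (if q.1 < q.2 then z q.1 * w q.2 + z q.2 * w q.1 else 0) *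
        ((if u q < dotd (X q.1) (X q.2) then (1:ℝ) else 0) - dotd (X q.1) (X q.2)) =
      (∑ i, ∑ j, if i < j then z i * g i j * w j else 0) +
      (∑ i, ∑ j, if i < j then z j * g i j * w i else 0) := by
    rw [Fintype.sum_prod_type]
    simp only [← Finset.sum_add_distrib]
    refine Finset.sum_congr rfl fun i _ => Finset.sum_congr rfl fun j _ => ?_
    split_ifs <;> simp [hg, *] <;> ring
  rw [e2, e3]
  have h4 : ∑ i, - (z i * dotd (X i) (X i) * w i) ≤ 1 := by
    calc ∑ i, - (z i * dotd (X i) (X i) * w i) ≤ ∑ i, (z i ^ 2 + w i ^ 2) / 2 := by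
          refine Finset.sum_le_sum fun i _ => ?_
          have h5 : |z i * dotd (X i) (X i) * w i| ≤ |z i| * |w i| := by
            rw [abs_mul, abs_mul]
            nlinarith [hX i, abs_nonneg (z i), abs_nonneg (w i), mul_nonneg (abs_nonneg (z i)) (abs_nonneg (w i))]
          have := neg_abs_le (z i * dotd (X i) (X i) * w i)
          nlinarith [sq_nonneg (|z i| - |w i|), sq_abs (z i), sq_abs (w i)]
      _ = (∑ i, z i ^ 2 + ∑ i, w i ^ 2) / 2 := by rw [← Finset.sum_add_distrib, Finset.sum_div]
      _ ≤ 1 := by linarith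
  linarith

lemma exp_quad {n d : ℕ} (X : Fin n → Fin d → ℝ) (z w : Fin n → ℝ)
    (hX : ∀ i j, 0 ≤ dotd (X i) (X j) ∧ dotd (X i) (X j) ≤ 1)
    (hz : ∑ i, z i ^ 2 ≤ 1) (hw : ∑ i, w i ^ 2 ≤ 1) {t : ℝ} (ht : 0 < t) :
    ∫⁻ u, ENNReal.ofReal (Real.exp (t * (z ⬝ᵥ
      ((Matrix.of (adjOf 1 X u) - Matrix.of X * (Matrix.of X)ᵀ) *ᵥ w)))) ∂(pairUniform n)
      ≤ ENNReal.ofReal (Real.exp (t + t ^ 2 / 2)) := by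
  set c : Fin n × Fin n → ℝ := fun q =>
    if q.1 < q.2 then z q.1 * w q.2 + z q.2 * w q.1 else 0 with hc
  set f : Fin n × Fin n → ℝ → ℝ := fun q x => Real.exp (t * c q *
    ((if x < dotd (X q.1) (X q.2) then (1:ℝ) else 0) - dotd (X q.1) (X q.2))) with hf
  have hfi : ∀ q, Integrable (f q) ((volume : Measure ℝ).restrict (Set.Icc (0:ℝ) 1)) := fun q =>
    (mgf_unif _ (hX _ _).1 (hX _ _).2 _).1
  have h_integ : Integrable (fun u : Fin n × Fin n → ℝ => ∏ q, f q (u q)) (pairUniform n) :=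
    Integrable.fintype_prod hfi
  have hcs : ∑ q, c q ^ 2 ≤ 4 := by
    calc ∑ q, c q ^ 2 ≤ ∑ q : Fin n × Fin n, (2 * (z q.1 ^ 2 * w q.2 ^ 2) + 2 * (z q.2 ^ 2 * w q.1 ^ 2)) := by
          refine Finset.sum_le_sum fun q _ => ?_
          simp only [hc]
          split_ifs
          · nlinarith [sq_nonneg (z q.1 * w q.2 - z q.2 * w q.1)]
          · rw [zero_pow two_ne_zero]; positivity
      _ = 4 * ((∑ i, z i ^ 2) * ∑ j, w j ^ 2) := by
          rw [Finset.sum_add_distrib, ← Finset.mul_sum, ← Finset.mul_sum, Fintype.sum_prod_type,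
            Fintype.sum_prod_type, Finset.sum_mul_sum]
          rw [Finset.sum_comm (f := fun x y => z y ^ 2 * w x ^ 2)]
          ring
      _ ≤ 4 * (1 * 1) := by
          gcongr
      _ = 4 := by norm_num
  calc _ ≤ ∫⁻ u, ENNReal.ofReal (Real.exp t * ∏ q, f q (u q)) ∂(pairUniform n) := by
        refine lintegral_mono fun u => ENNReal.ofReal_le_ofReal ?_
        have h := quad_expand X u z w (fun i => by rw [abs_of_nonneg (hX i i).1]; exact (hX i i).2) hz hw
        rw [hf, ← Real.exp_sum, ← Real.exp_add]
        apply Real.exp_le_exp.2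
        have h2 := mul_le_mul_of_nonneg_left h ht.le
        refine h2.trans (le_of_eq ?_)
        rw [mul_add, mul_one, Finset.mul_sum]
        congr 1
        refine Finset.sum_congr rfl fun q _ => ?_
        rw [mul_assoc]
    _ = ENNReal.ofReal (∫ u, Real.exp t * ∏ q, f q (u q) ∂(pairUniform n)) := by
        rw [ofReal_integral_eq_lintegral_ofReal (h_integ.const_mul _)]
        exact Filter.Eventually.of_forall fun u =>
          mul_nonneg (Real.exp_pos _).le (Finset.prod_nonneg fun q _ => (Real.exp_pos _).le)
    _ ≤ _ := by
        apply ENNReal.ofReal_le_ofReal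
        rw [integral_const_mul, pairUniform, integral_fintype_prod_eq_prod]
        calc _ ≤ Real.exp t * ∏ q, Real.exp ((t * c q) ^ 2 / 8) := by
              gcongr with q
              exact (mgf_unif _ (hX _ _).1 (hX _ _).2 _).2
          _ ≤ _ := by
              rw [← Real.exp_sum, ← Real.exp_add]
              apply Real.exp_le_exp.2
              have : ∑ q, (t * c q) ^ 2 / 8 = t ^ 2 / 8 * ∑ q, c q ^ 2 := by
                rw [Finset.mul_sum]; refine Finset.sum_congr rfl fun q _ => by ring
              rw [this]
              nlinarith [sq_nonneg t]

lemma meas_adj_entry {n d : ℕ} (X : Fin n → Fin d → ℝ) : Measurable (fun u => adjOf 1 X u) := by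
  refine measurable_pi_lambda _ fun i => measurable_pi_lambda _ fun j => ?_
  unfold adjOf
  split_ifs
  · exact measurable_const
  · exact Measurable.ite (measurableSet_lt (measurable_pi_apply _) measurable_const)
      measurable_const measurable_const

lemma meas_quad {n d : ℕ} (X : Fin n → Fin d → ℝ) (z w : Fin n → ℝ) (t : ℝ) :
    Measurable (fun u => ENNReal.ofReal (Real.exp (t * (z ⬝ᵥ
      ((Matrix.of (adjOf 1 X u) - Matrix.of X * (Matrix.of X)ᵀ) *ᵥ w))))) := by
  have h := meas_adj_entry X
  have h2 : ∀ i j, Measurable fun u => adjOf 1 X u i j := fun i j =>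
    (measurable_pi_apply j).comp ((measurable_pi_apply i).comp h)
  simp only [dotProduct, mulVec, Matrix.sub_apply, Matrix.of_apply]
  have h3 : Measurable fun u => ∑ x, z x * ∑ y, (adjOf 1 X u x y - (Matrix.of X * (Matrix.of X)ᵀ) x y) * w y :=
    Finset.measurable_sum _ fun i _ => Measurable.const_mul (Finset.measurable_sum _ fun j _ =>
      ((h2 i j).sub_const _).mul_const _) _
  exact (Real.measurable_exp.comp (h3.const_mul t)).ennreal_ofReal

lemma exp_opnorm {n d : ℕ} (hn : 0 < n) (X : Fin n → Fin d → ℝ)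
    (hX : ∀ i j, 0 ≤ dotd (X i) (X j) ∧ dotd (X i) (X j) ≤ 1) :
    ∫⁻ u, ENNReal.ofReal ‖Matrix.of (adjOf 1 X u) - Matrix.of X * (Matrix.of X)ᵀ‖ ∂(pairUniform n)
      ≤ ENNReal.ofReal (78 * Real.sqrt n) := by
  obtain ⟨N, hNc, hN1, hN2⟩ := exists_net n hn
  have hn1 : (1:ℝ) ≤ n := by exact_mod_cast hn
  set t := Real.sqrt n with ht
  have ht0 : 0 < t := Real.sqrt_pos.2 (by linarith)
  have htt : t ^ 2 = n := Real.sq_sqrt (by linarith)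
  have ht1 : t ≤ n := by rw [← htt]; nlinarith [Real.one_le_sqrt.2 hn1]
  have hsq : ∀ z ∈ N, ∑ i, (z i) ^ 2 ≤ 1 := by
    intro z hz
    have := EuclideanSpace.norm_sq_eq z
    simp only [Real.norm_eq_abs, sq_abs] at this
    rw [← this]; exact pow_le_one₀ (norm_nonneg _) (hN1 z hz)
  calc _ ≤ ∫⁻ u, (ENNReal.ofReal (76 * t) + ∑ z ∈ N, ∑ w ∈ N, ENNReal.ofReal (2 / t * Real.exp (-(38 * n))) *
        ENNReal.ofReal (Real.exp (t * ((z : Fin n → ℝ) ⬝ᵥ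
      ((Matrix.of (adjOf 1 X u) - Matrix.of X * (Matrix.of X)ᵀ) *ᵥ (w : Fin n → ℝ)))))) ∂(pairUniform n) := by
        refine lintegral_mono fun u => ?_
        set M := Matrix.of (adjOf 1 X u) - Matrix.of X * (Matrix.of X)ᵀ
        have h1 := exp_norm_le N hN1 hN2 M ht0
        have h2 : t * ‖M‖ / 2 - 38 * n ≤ Real.exp (-(38*n)) * ∑ z ∈ N, ∑ w ∈ N, Real.exp (t * ((z : Fin n → ℝ) ⬝ᵥ (M *ᵥ (w : Fin n → ℝ)))) := by
          calc t * ‖M‖ / 2 - 38 * n ≤ Real.exp (t * ‖M‖ / 2 - 38 * n) := by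
                linarith [Real.add_one_le_exp (t * ‖M‖ / 2 - 38 * n)]
            _ = Real.exp (-(38*n)) * Real.exp (t * ‖M‖ / 2) := by rw [← Real.exp_add]; congr 1; ring
            _ ≤ _ := by gcongr
        have h3 : ‖M‖ ≤ 76 * t + 2 / t * Real.exp (-(38*n)) * ∑ z ∈ N, ∑ w ∈ N, Real.exp (t * ((z : Fin n → ℝ) ⬝ᵥ (M *ᵥ (w : Fin n → ℝ)))) := by
          have h4 := mul_le_mul_of_nonneg_left h2 (show 0 ≤ 2 / t by positivity)
          have h5 : 2 / t * (t * ‖M‖ / 2 - 38 * n) = ‖M‖ - 76 * t := by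
            rw [← htt]; field_simp; ring
          rw [h5] at h4
          rw [mul_assoc]; linarith
        simp only [← ENNReal.ofReal_mul (show 0 ≤ 2 / t * Real.exp (-(38 * (n:ℝ))) by positivity)]
        have h6 : ∀ z ∈ N, ∑ w ∈ N, ENNReal.ofReal (2 / t * Real.exp (-(38 * n)) * Real.exp (t * ((z : Fin n → ℝ) ⬝ᵥ (M *ᵥ (w : Fin n → ℝ))))) =
            ENNReal.ofReal (∑ w ∈ N, 2 / t * Real.exp (-(38 * n)) * Real.exp (t * ((z : Fin n → ℝ) ⬝ᵥ (M *ᵥ (w : Fin n → ℝ))))) :=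
          fun z _ => (ENNReal.ofReal_sum_of_nonneg fun w _ => by positivity).symm
        rw [Finset.sum_congr rfl h6, ← ENNReal.ofReal_sum_of_nonneg (fun z _ => Finset.sum_nonneg fun w _ => by positivity),
          ← ENNReal.ofReal_add (by positivity) (Finset.sum_nonneg fun z _ => Finset.sum_nonneg fun w _ => by positivity)]
        apply ENNReal.ofReal_le_ofReal
        simp only [← Finset.mul_sum]
        exact h3
    _ = ENNReal.ofReal (76 * t) + ∑ z ∈ N, ∑ w ∈ N, ENNReal.ofReal (2 / t * Real.exp (-(38 * n))) *
        ∫⁻ u, ENNReal.ofReal (Real.exp (t * ((z : Fin n → ℝ) ⬝ᵥ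
      ((Matrix.of (adjOf 1 X u) - Matrix.of X * (Matrix.of X)ᵀ) *ᵥ (w : Fin n → ℝ))))) ∂(pairUniform n) := by
        rw [lintegral_add_left measurable_const, lintegral_const, measure_univ, mul_one,
          lintegral_finsetSum _ fun z _ => Finset.measurable_sum _ fun w _ => (meas_quad X _ _ t).const_mul _]
        congr 1
        refine Finset.sum_congr rfl fun z _ => ?_
        rw [lintegral_finsetSum _ fun w _ => (meas_quad X _ _ t).const_mul _]
        refine Finset.sum_congr rfl fun w _ => ?_
        rw [lintegral_const_mul _ (meas_quad X _ _ t)]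
    _ ≤ ENNReal.ofReal (76 * t) + ∑ z ∈ N, ∑ w ∈ N, ENNReal.ofReal (2 / t * Real.exp (-(38 * n))) *
        ENNReal.ofReal (Real.exp (t + t ^ 2 / 2)) := by
        gcongr with z hz w hw
        exact exp_quad X z w hX (hsq z hz) (hsq w hw) ht0
    _ = ENNReal.ofReal (76 * t + N.card * N.card * ((2 / t * Real.exp (-(38 * n))) * Real.exp (t + t ^ 2 / 2))) := by
        rw [ENNReal.ofReal_add (by positivity) (by positivity)]
        congr 1
        rw [Finset.sum_const, Finset.sum_const, nsmul_eq_mul, nsmul_eq_mul, ← ENNReal.ofReal_mul (by positivity),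
          ENNReal.ofReal_mul (p := (N.card : ℝ) * N.card) (by positivity),
          ENNReal.ofReal_mul (p := (N.card : ℝ)) (by positivity), ENNReal.ofReal_natCast, mul_assoc (N.card : ℝ≥0∞)]
    _ ≤ _ := by
        apply ENNReal.ofReal_le_ofReal
        have : (N.card : ℝ) * N.card * ((2 / t * Real.exp (-(38 * n))) * Real.exp (t + t ^ 2 / 2)) ≤ 2 * t := by
          calc _ ≤ Real.exp (18 * n) * Real.exp (18 * n) * ((2 / t * Real.exp (-(38 * n))) * Real.exp (n + n / 2)) := by
                rw [htt]; gcongr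
            _ = 2 / t * Real.exp (-(n/2)) := by
                rw [show Real.exp (18 * n) * Real.exp (18 * n) * ((2 / t * Real.exp (-(38 * n))) * Real.exp (n + n / 2))
                  = 2 / t * ((Real.exp (18 * n) * Real.exp (18 * n)) * (Real.exp (-(38 * n)) * Real.exp (n + n / 2))) by ring,
                  ← Real.exp_add, ← Real.exp_add, ← Real.exp_add]
                congr 2; ring
            _ ≤ 2 / t * 1 := by
                gcongr; exact Real.exp_le_one_iff.2 (by linarith)
            _ ≤ 2 * t := by
                rw [mul_one, div_le_iff₀ ht0]; nlinarith
        linarith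

lemma adj_symm {n d : ℕ} (X : Fin n → Fin d → ℝ) (u : Fin n × Fin n → ℝ) (i j : Fin n) :
    adjOf 1 X u i j = adjOf 1 X u j i := by
  have hsym : dotd (X i) (X j) = dotd (X j) (X i) := by simp [dotd, mul_comm]
  simp [adjOf, min_comm i j, max_comm i j, hsym, eq_comm]

lemma ase_l1 {n d : ℕ} (hn : 0 < n) (hdn : d ≤ n) (X : Fin n → Fin d → ℝ)
    (hX : ∀ i j, 0 ≤ dotd (X i) (X j) ∧ dotd (X i) (X j) ≤ 1) :
    ∫⁻ u, ENNReal.ofReal (∑ i, ∑ j, |dotd (ase d (adjOf 1 X u) i) (ase d (adjOf 1 X u) j) -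
        dotd (X i) (X j)|) ∂(pairUniform n)
      ≤ ENNReal.ofReal (n * (8 * d) * (78 * Real.sqrt n)) := by
  have key : ∀ u, ∑ i, ∑ j, |dotd (ase d (adjOf 1 X u) i) (ase d (adjOf 1 X u) j) -
        dotd (X i) (X j)| ≤ n * (8 * d) * ‖Matrix.of (adjOf 1 X u) - Matrix.of X * (Matrix.of X)ᵀ‖ := by
    intro u
    set m := ‖Matrix.of (adjOf 1 X u) - Matrix.of X * (Matrix.of X)ᵀ‖ with hm
    have hm0 : 0 ≤ m := norm_nonneg _
    have h1 := ase_frob (adjOf 1 X u) (adj_symm X u) X _ (ase_isASE hdn _ (adj_symm X u))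
    rw [← hm] at h1
    set Xh := ase d (adjOf 1 X u)
    apply abs_le_of_sq_le_sq' _ (by positivity) |>.2
    have h2 : (∑ q : Fin n × Fin n, |dotd (Xh q.1) (Xh q.2) - dotd (X q.1) (X q.2)|) ^ 2 ≤
        (Finset.univ : Finset (Fin n × Fin n)).card * ∑ q : Fin n × Fin n, |dotd (Xh q.1) (Xh q.2) - dotd (X q.1) (X q.2)| ^ 2 :=
      sq_sum_le_card_mul_sum_sq
    simp only [sq_abs, Fintype.sum_prod_type, Finset.card_univ, Fintype.card_prod, Fintype.card_fin] at h2
    refine h2.trans ((mul_le_mul_of_nonneg_left h1 (by positivity)).trans ?_)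
    push_cast
    have : (d:ℝ) ≤ d * d := by
      rcases Nat.eq_zero_or_pos d with h | h
      · simp [h]
      · have : (1:ℝ) ≤ d := by exact_mod_cast h
        nlinarith
    have h3 : 0 ≤ (n:ℝ) * n * m ^ 2 := by positivity
    nlinarith
  calc _ ≤ ∫⁻ u, ENNReal.ofReal (n * (8 * d)) * ENNReal.ofReal ‖Matrix.of (adjOf 1 X u) - Matrix.of X * (Matrix.of X)ᵀ‖ ∂(pairUniform n) := by
        refine lintegral_mono fun u => ?_
        rw [← ENNReal.ofReal_mul (by positivity)]
        exact ENNReal.ofReal_le_ofReal (key u)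
    _ = ENNReal.ofReal (n * (8 * d)) * ∫⁻ u, ENNReal.ofReal ‖Matrix.of (adjOf 1 X u) - Matrix.of X * (Matrix.of X)ᵀ‖ ∂(pairUniform n) := by
        rw [lintegral_const_mul' _ _ ENNReal.ofReal_ne_top]
    _ ≤ ENNReal.ofReal (n * (8 * d)) * ENNReal.ofReal (78 * Real.sqrt n) := by
        gcongr; exact exp_opnorm hn X hX
    _ = _ := by rw [← ENNReal.ofReal_mul (by positivity)]

end

/-- Dyadic cell of level `l`. -/
def cellOf {d : ℕ} (l : ℕ) (x : Fin d → ℝ) : Fin d → ℤ := fun i => ⌊2 ^ l * x i⌋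

lemma cell_nest {d : ℕ} (l : ℕ) (x y : Fin d → ℝ) (h : cellOf (l+1) x = cellOf (l+1) y) :
    cellOf l x = cellOf l y := by
  ext i
  have h1 := congrFun h i
  simp only [cellOf] at h1 ⊢
  have e : ∀ x : ℝ, (2:ℝ) ^ l * x = (2 ^ (l+1) * x) / ((2:ℕ):ℝ) := by
    intro x; push_cast; ring
  rw [e, e, Int.floor_div_natCast, Int.floor_div_natCast, h1]

lemma cell_close {d : ℕ} (l : ℕ) (x y : Fin d → ℝ) (h : cellOf l x = cellOf l y) (i : Fin d) :
    |x i - y i| ≤ (1/2) ^ l := by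
  have h1 := Int.abs_sub_lt_one_of_floor_eq_floor (congrFun h i)
  rw [← mul_sub, abs_mul, abs_of_pos (by positivity : (0:ℝ) < 2 ^ l)] at h1
  rw [one_div, inv_pow, ← one_div, le_div_iff₀ (by positivity)]
  linarith

lemma cell_chain {d : ℕ} (L : ℕ) (x y : Fin d → ℝ) (hx : ∀ i, |x i| ≤ 1) (hy : ∀ i, |y i| ≤ 1)
    (i : Fin d) : |x i - y i| ≤ (1/2) ^ L + ∑ l ∈ Finset.range (L+1),
      2 * (1/2) ^ l * (if cellOf l x ≠ cellOf l y then (1:ℝ) else 0) := by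
  induction L with
  | zero =>
    by_cases h : cellOf 0 x = cellOf 0 y
    · simpa [h] using cell_close 0 x y h i
    · have h1 := abs_sub (x i) (y i)
      simp [h]; linarith [hx i, hy i]
  | succ L ih =>
    by_cases h : cellOf (L+1) x = cellOf (L+1) y
    · refine (cell_close _ x y h i).trans (le_add_of_nonneg_right (Finset.sum_nonneg fun l _ => ?_))
      positivity
    · rw [Finset.sum_range_succ]
      simp only [ne_eq, h, not_false_eq_true, if_true] at ih ⊢
      have : (1/2:ℝ)^(L+1) = (1/2)^L/2 := by ring
      have h2 : (0:ℝ) < (1/2)^L := by positivity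
      rw [this]; linarith

/-- The cells meeting the cube. -/
def cellSet (d l : ℕ) : Finset (Fin d → ℤ) :=
  Fintype.piFinset fun _ => Finset.Icc (-(2 ^ l : ℤ)) (2 ^ l)

lemma cell_mem {d : ℕ} (l : ℕ) (x : Fin d → ℝ) (hx : ∀ i, |x i| ≤ 1) : cellOf l x ∈ cellSet d l := by
  refine Fintype.mem_piFinset.2 fun i => Finset.mem_Icc.2 ?_
  have h := abs_le.1 (hx i)
  have h2 : (0:ℝ) < 2 ^ l := by positivity
  simp only [cellOf]
  constructor
  · rw [Int.le_floor]; push_cast; nlinarith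
  · have : (⌊2 ^ l * x i⌋ : ℝ) ≤ 2 ^ l := (Int.floor_le _).trans (by nlinarith)
    exact_mod_cast this

lemma cellSet_card (d l : ℕ) : ((cellSet d l).card : ℝ) ≤ (3 * 2 ^ l) ^ d := by
  unfold cellSet
  rw [Fintype.card_piFinset]
  simp only [Int.card_Icc, Finset.prod_const, Finset.card_univ, Fintype.card_fin]
  have : ((2:ℤ) ^ l + 1 - -2 ^ l).toNat = 2 * 2 ^ l + 1 := by
    have : (2:ℤ) ^ l + 1 - -2 ^ l = ((2 * 2 ^ l + 1 : ℕ) : ℤ) := by push_cast; ring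
    rw [this, Int.toNat_natCast]
  rw [this]
  push_cast
  have h1 : (1:ℝ) ≤ 2 ^ l := one_le_pow₀ (by norm_num)
  gcongr; linarith

lemma measurable_cellOf {d : ℕ} (l : ℕ) : Measurable (cellOf (d := d) l) :=
  measurable_pi_lambda _ fun i => Int.measurable_floor.comp ((measurable_pi_apply i).const_mul _)

lemma meas_count {α Ω : Type*} [MeasurableSpace α] [MeasurableSpace Ω] (n : ℕ) (f : Fin n → Ω → α)
    (hf : ∀ k, Measurable (f k)) (S : Set α) (hS : MeasurableSet S) :
    Measurable (fun ω => ((Finset.univ.filter fun k => f k ω ∈ S).card : ℝ)) := by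
  simp only [Finset.natCast_card_filter]
  exact Finset.measurable_sum _ fun k _ => Measurable.ite (hf k hS) measurable_const measurable_const

lemma count_sq {α : Type*} [MeasurableSpace α] (ν : Measure α) [IsProbabilityMeasure ν] (n : ℕ)
    (S : Set α) (hS : MeasurableSet S) :
    ∫⁻ Y : Fin n → α, ENNReal.ofReal ((((Finset.univ.filter fun k => Y k ∈ S).card : ℝ) - n * ν.real S) ^ 2)
      ∂(Measure.pi fun _ => ν) ≤ ENNReal.ofReal (n * ν.real S) := by
  set g : α → ℝ := S.indicator (fun _ => 1) with hg
  have hgm : Measurable g := measurable_const.indicator hS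
  have hgb : ∀ x, ‖g x‖ ≤ 1 := fun x => by
    simp only [hg, Set.indicator]; split_ifs <;> simp
  have hgL : MemLp g 2 ν := MemLp.of_bound hgm.aestronglyMeasurable 1 (Filter.Eventually.of_forall hgb)
  have hgi : ∫ x, g x ∂ν = ν.real S := by
    rw [hg, integral_indicator_const _ hS]; simp
  set T : (Fin n → α) → ℝ := ∑ k : Fin n, fun Y => g (Y k) with hT
  have hTe : ∀ Y, T Y = ((Finset.univ.filter fun k => Y k ∈ S).card : ℝ) := by
    intro Y
    simp only [hT, Finset.sum_apply, Finset.natCast_card_filter, hg, Set.indicator]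
  have hTm : Measurable T := by
    have : T = fun Y => ∑ k, g (Y k) := by ext Y; simp [hT]
    rw [this]; exact Finset.measurable_sum _ fun k _ => hgm.comp (measurable_pi_apply k)
  have hTb : ∀ Y, ‖T Y‖ ≤ n := by
    intro Y
    rw [hTe, Real.norm_eq_abs, abs_of_nonneg (by positivity)]
    have := Finset.card_filter_le (Finset.univ : Finset (Fin n)) (fun k => Y k ∈ S)
    rw [Finset.card_univ, Fintype.card_fin] at this
    exact_mod_cast this
  have hmean : ∫ Y, T Y ∂(Measure.pi fun _ : Fin n => ν) = n * ν.real S := by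
    simp only [hT, Finset.sum_apply]
    rw [integral_finsetSum _ fun k _ => integrable_comp_eval (hgL.integrable one_le_two)]
    have : ∀ k : Fin n, ∫ Y, g (Y k) ∂(Measure.pi fun _ : Fin n => ν) = ν.real S := fun k => by
      rw [integral_comp_eval (μ := fun _ : Fin n => ν) (i := k) hgm.aestronglyMeasurable, hgi]
    simp [this]
  have hvar := ProbabilityTheory.variance_sum_pi (μ := fun _ : Fin n => ν) (X := fun _ : Fin n => g) (fun _ => hgL)
  rw [← hT, ProbabilityTheory.variance_eq_integral hTm.aemeasurable, hmean] at hvar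
  have hvg : ProbabilityTheory.variance g ν ≤ ν.real S := by
    refine (ProbabilityTheory.variance_le_expectation_sq hgm.aestronglyMeasurable).trans (le_of_eq ?_)
    rw [← hgi]
    congr 1; ext x; simp only [hg, Set.indicator, Pi.pow_apply]; split_ifs <;> simp
  have h_integ : Integrable (fun Y => (T Y - n * ν.real S) ^ 2) (Measure.pi fun _ : Fin n => ν) := by
    refine Integrable.of_bound ((hTm.sub_const _).pow_const 2).aestronglyMeasurable ((n + n * ν.real S)^2)
      (Filter.Eventually.of_forall fun Y => ?_)
    rw [norm_pow]
    gcongr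
    refine (norm_sub_le _ _).trans (add_le_add (hTb Y) (le_of_eq ?_))
    rw [Real.norm_eq_abs, abs_of_nonneg (by positivity)]
  simp only [← hTe]
  rw [← ofReal_integral_eq_lintegral_ofReal h_integ (Filter.Eventually.of_forall fun Y => sq_nonneg _), hvar]
  apply ENNReal.ofReal_le_ofReal
  simp only [Finset.sum_const, Finset.card_univ, Fintype.card_fin, nsmul_eq_mul]
  gcongr

lemma count_mean {α : Type*} [MeasurableSpace α] (ν : Measure α) [IsProbabilityMeasure ν] (n : ℕ)
    (S : Set α) (hS : MeasurableSet S) :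
    ∫⁻ Y : Fin n → α, ENNReal.ofReal ((Finset.univ.filter fun k => Y k ∈ S).card : ℝ)
      ∂(Measure.pi fun _ => ν) = ENNReal.ofReal (n * ν.real S) := by
  have : ∀ Y : Fin n → α, ENNReal.ofReal ((Finset.univ.filter fun k => Y k ∈ S).card : ℝ) =
      ∑ k, S.indicator 1 (Y k) := by
    intro Y
    rw [ENNReal.ofReal_natCast, Finset.natCast_card_filter]
    simp [Set.indicator]
  simp only [this]
  have hm : Measurable (S.indicator (1 : α → ℝ≥0∞)) := measurable_const.indicator hS
  rw [lintegral_finsetSum (f := fun k (Y : Fin n → α) => S.indicator 1 (Y k)) _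
    fun k _ => hm.comp (measurable_pi_apply k)]
  have h2 : ∀ k : Fin n, ∫⁻ Y, S.indicator (1 : α → ℝ≥0∞) (Y k) ∂(Measure.pi fun _ : Fin n => ν) = ν S := fun k => by
    rw [(measurePreserving_eval (fun _ : Fin n => ν) k).lintegral_comp hm]
    simp [hS]
  simp only [h2, Finset.sum_const, Finset.card_univ, Fintype.card_fin, nsmul_eq_mul]
  rw [ENNReal.ofReal_mul (by positivity), ENNReal.ofReal_natCast, measureReal_def,
    ENNReal.ofReal_toReal (measure_ne_top _ _)]

lemma uniformFin_real {n : ℕ} (S : Finset (Fin n)) : (uniformFin n).real (S : Set (Fin n)) = (S.card : ℝ) / n := by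
  simp only [uniformFin, measureReal_def, Measure.smul_apply, Measure.count_apply_finset]
  rw [ENNReal.smul_def, smul_eq_mul, ENNReal.toReal_mul]
  simp
  ring

lemma uniformFin_prob {n : ℕ} (hn : 0 < n) : IsProbabilityMeasure (uniformFin n) := by
  constructor
  have : (n : ℝ≥0) ≠ 0 := by exact_mod_cast hn.ne'
  simp only [uniformFin, Measure.smul_apply, Measure.count_univ]
  rw [ENNReal.smul_def, smul_eq_mul]
  simp
  rw [ENNReal.coe_inv this]
  exact ENNReal.inv_mul_cancel (by exact_mod_cast this) (by simp)

instance uniformFin_sf (n : ℕ) : IsFiniteMeasure (uniformFin n) := by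
  unfold uniformFin; infer_instance

lemma meas_ev {d n : ℕ} (k : Fin n) :
    Measurable fun q : (Fin n → Fin d → ℝ) × (Fin n → Fin n) × (Fin n → Fin d → ℝ) => q.1 (q.2.1 k) := by
  have hmev : Measurable fun q : (Fin n → Fin d → ℝ) × (Fin n) => q.1 q.2 :=
    measurable_from_prod_countable_left fun i => measurable_pi_apply i
  have h : Measurable fun q : (Fin n → Fin d → ℝ) × (Fin n → Fin n) × (Fin n → Fin d → ℝ) => (q.1, q.2.1 k) :=
    measurable_fst.prodMk ((measurable_pi_apply k).comp (measurable_fst.comp measurable_snd))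
  exact hmev.comp h

lemma meas_diff_sq {d n : ℕ} (S : Set (Fin d → ℝ)) (hS : MeasurableSet S) :
    Measurable fun q : (Fin n → Fin d → ℝ) × (Fin n → Fin n) × (Fin n → Fin d → ℝ) => ENNReal.ofReal
      ((((Finset.univ.filter fun k => q.1 (q.2.1 k) ∈ S).card : ℝ) -
        ((Finset.univ.filter fun k => q.2.2 k ∈ S).card : ℝ)) ^ 2) := by
  have h1 := meas_count n (fun k (q : (Fin n → Fin d → ℝ) × (Fin n → Fin n) × (Fin n → Fin d → ℝ)) =>
    q.1 (q.2.1 k)) meas_ev S hS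
  have h2 := meas_count n (fun k (q : (Fin n → Fin d → ℝ) × (Fin n → Fin n) × (Fin n → Fin d → ℝ)) =>
    q.2.2 k) (fun k => (measurable_pi_apply k).comp (measurable_snd.comp measurable_snd)) S hS
  exact ((h1.sub h2).pow_const 2).ennreal_ofReal

set_option maxHeartbeats 2000000 in
lemma one_cell {d n : ℕ} (hn : 0 < n) (F : Measure (Fin d → ℝ)) [IsProbabilityMeasure F]
    (S : Set (Fin d → ℝ)) (hS : MeasurableSet S) :
    ∫⁻ q : (Fin n → Fin d → ℝ) × (Fin n → Fin n) × (Fin n → Fin d → ℝ), ENNReal.ofReal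
      ((((Finset.univ.filter fun k => q.1 (q.2.1 k) ∈ S).card : ℝ) -
        ((Finset.univ.filter fun k => q.2.2 k ∈ S).card : ℝ)) ^ 2)
      ∂((Measure.pi fun _ => F).prod ((Measure.pi fun _ => uniformFin n).prod (Measure.pi fun _ => F)))
      ≤ ENNReal.ofReal (9 * n * F.real S) := by
  have := uniformFin_prob hn
  set NX : (Fin n → Fin d → ℝ) → ℝ := fun X => ((Finset.univ.filter fun k => X k ∈ S).card : ℝ) with hNX
  set NI : (Fin n → Fin d → ℝ) → (Fin n → Fin n) → ℝ := fun X I => ((Finset.univ.filter fun k => X (I k) ∈ S).card : ℝ) with hNI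
  have hNXm : Measurable NX := meas_count n (fun k (X : Fin n → Fin d → ℝ) => X k) (fun k => measurable_pi_apply k) S hS
  have hNIm : Measurable fun q : (Fin n → Fin d → ℝ) × (Fin n → Fin n) × (Fin n → Fin d → ℝ) => NI q.1 q.2.1 :=
    meas_count n (fun k (q : (Fin n → Fin d → ℝ) × (Fin n → Fin n) × (Fin n → Fin d → ℝ)) => q.1 (q.2.1 k)) meas_ev S hS
  have hm1 : Measurable fun q : (Fin n → Fin d → ℝ) × (Fin n → Fin n) × (Fin n → Fin d → ℝ) =>
      ENNReal.ofReal ((NI q.1 q.2.1 - NX q.1)^2) :=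
    ((hNIm.sub (hNXm.comp measurable_fst)).pow_const 2).ennreal_ofReal
  have hm2 : Measurable fun X : (Fin n → Fin d → ℝ)  =>
      ENNReal.ofReal ((NX X - n * F.real S)^2) :=
    ((hNXm.sub_const _).pow_const 2).ennreal_ofReal
  calc _ ≤ ∫⁻ q : (Fin n → Fin d → ℝ) × (Fin n → Fin n) × (Fin n → Fin d → ℝ),
        (3 * (ENNReal.ofReal ((NI q.1 q.2.1 - NX q.1)^2) + (ENNReal.ofReal ((NX q.1 - n * F.real S)^2)
          + ENNReal.ofReal ((NX q.2.2 - n * F.real S)^2))))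
        ∂((Measure.pi fun _ => F).prod ((Measure.pi fun _ => uniformFin n).prod (Measure.pi fun _ => F))) := by
        refine lintegral_mono fun q => ?_
        rw [← ENNReal.ofReal_add (by positivity) (by positivity), ← ENNReal.ofReal_add (by positivity) (by positivity),
          show (3:ℝ≥0∞) = ENNReal.ofReal 3 by simp, ← ENNReal.ofReal_mul (by norm_num)]
        apply ENNReal.ofReal_le_ofReal
        change (NI q.1 q.2.1 - NX q.2.2)^2 ≤ _
        generalize NI q.1 q.2.1 = a
        generalize NX q.1 = b
        generalize n * F.real S = c
        generalize NX q.2.2 = e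
        nlinarith [sq_nonneg ((a-b)-(b-c)), sq_nonneg ((a-b)+(e-c)), sq_nonneg ((b-c)+(e-c))]
    _ = 3 * (∫⁻ q : (Fin n → Fin d → ℝ) × (Fin n → Fin n) × (Fin n → Fin d → ℝ),
        ENNReal.ofReal ((NI q.1 q.2.1 - NX q.1)^2) ∂((Measure.pi fun _ => F).prod ((Measure.pi fun _ => uniformFin n).prod (Measure.pi fun _ => F)))
        + (∫⁻ X, ENNReal.ofReal ((NX X - n * F.real S)^2) ∂(Measure.pi fun _ => F)
          + ∫⁻ X, ENNReal.ofReal ((NX X - n * F.real S)^2) ∂(Measure.pi fun _ => F))) := by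
        rw [lintegral_const_mul' _ _ (by simp), lintegral_add_left hm1,
          lintegral_add_left (f := fun q : (Fin n → Fin d → ℝ) × (Fin n → Fin n) × (Fin n → Fin d → ℝ) =>
            ENNReal.ofReal ((NX q.1 - n * F.real S)^2)) (hm2.comp measurable_fst)]
        congr 3
        · exact (measurePreserving_fst).lintegral_comp hm2
        · have h1 : MeasurePreserving (fun q : (Fin n → Fin d → ℝ) × (Fin n → Fin n) × (Fin n → Fin d → ℝ) => q.2.2)
            ((Measure.pi fun _ => F).prod ((Measure.pi fun _ => uniformFin n).prod (Measure.pi fun _ => F))) (Measure.pi fun _ => F) :=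
            measurePreserving_snd.comp measurePreserving_snd
          exact h1.lintegral_comp hm2
    _ ≤ 3 * (ENNReal.ofReal (n * F.real S) + (ENNReal.ofReal (n * F.real S) + ENNReal.ofReal (n * F.real S))) := by
        gcongr
        · rw [lintegral_prod _ hm1.aemeasurable]
          rw [← count_mean F n S hS]
          refine lintegral_mono fun X => ?_
          have h3 : ∫⁻ y, ENNReal.ofReal ((NI X y.1 - NX X)^2)
              ∂((Measure.pi fun _ : Fin n => uniformFin n).prod (Measure.pi fun _ : Fin n => F)) =
              ∫⁻ I, ENNReal.ofReal ((NI X I - NX X)^2) ∂(Measure.pi fun _ : Fin n => uniformFin n) :=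
            (measurePreserving_fst).lintegral_comp (f := fun I => ENNReal.ofReal ((NI X I - NX X)^2)) (measurable_of_countable _)
          refine (le_of_eq h3).trans ?_
          have h4 := count_sq (uniformFin n) n ((Finset.univ.filter fun i => X i ∈ S : Finset (Fin n)) : Set (Fin n)) (Set.toFinite _).measurableSet
          rw [uniformFin_real, mul_div_cancel₀ _ (by exact_mod_cast hn.ne')] at h4
          simpa using h4
        · exact count_sq F n S hS
        · exact count_sq F n S hS
    _ = _ := by
        rw [← ENNReal.ofReal_add (by positivity) (by positivity), ← ENNReal.ofReal_add (by positivity) (by positivity),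
          show (3:ℝ≥0∞) = ENNReal.ofReal 3 by simp, ← ENNReal.ofReal_mul (by norm_num)]
        congr 1; ring

set_option maxHeartbeats 2000000 in
lemma all_cells {d n : ℕ} (hn : 0 < n) (F : Measure (Fin d → ℝ)) [IsProbabilityMeasure F]
    {κ : Type*} [Countable κ] [MeasurableSpace κ] [MeasurableSingletonClass κ]
    (c : (Fin d → ℝ) → κ) (hc : Measurable c) (S : Finset κ) (K : ℝ) (hK : 0 < K) (hSK : S.card ≤ K) :
    ∫⁻ q : (Fin n → Fin d → ℝ) × (Fin n → Fin n) × (Fin n → Fin d → ℝ), ENNReal.ofReal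
      (∑ Q ∈ S, |((Finset.univ.filter fun k => c (q.1 (q.2.1 k)) = Q).card : ℝ) -
        ((Finset.univ.filter fun k => c (q.2.2 k) = Q).card : ℝ)|)
      ∂((Measure.pi fun _ => F).prod ((Measure.pi fun _ => uniformFin n).prod (Measure.pi fun _ => F)))
      ≤ ENNReal.ofReal (5 * Real.sqrt (n * K)) := by
  have := uniformFin_prob hn
  have hn' : (0:ℝ) < n := by exact_mod_cast hn
  set s := Real.sqrt (n / K) with hs
  have hs0 : 0 < s := Real.sqrt_pos.2 (by positivity)
  have hmQ : ∀ Q, MeasurableSet (c ⁻¹' {Q}) := fun Q => hc (measurableSet_singleton Q)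
  have hsum : ∑ Q ∈ S, F.real (c ⁻¹' {Q}) ≤ 1 := by
    rw [← measureReal_biUnion_finset (fun Q _ R _ h => by
      refine Set.disjoint_left.2 fun x hx hx2 => h ?_
      rw [← show c x = Q from hx, ← show c x = R from hx2]) (fun Q _ => hmQ Q)]
    exact measureReal_le_one
  have hss : s * s = n / K := Real.mul_self_sqrt (by positivity)
  calc _ ≤ ∫⁻ q : (Fin n → Fin d → ℝ) × (Fin n → Fin n) × (Fin n → Fin d → ℝ), (ENNReal.ofReal (K * s / 2) +
        ENNReal.ofReal (1 / (2 * s)) * ∑ Q ∈ S, ENNReal.ofReal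
      ((((Finset.univ.filter fun k => q.1 (q.2.1 k) ∈ c ⁻¹' {Q}).card : ℝ) -
        ((Finset.univ.filter fun k => q.2.2 k ∈ c ⁻¹' {Q}).card : ℝ)) ^ 2))
      ∂((Measure.pi fun _ => F).prod ((Measure.pi fun _ => uniformFin n).prod (Measure.pi fun _ => F))) := by
        refine lintegral_mono fun q => ?_
        rw [← ENNReal.ofReal_sum_of_nonneg (fun Q _ => sq_nonneg _), ← ENNReal.ofReal_mul (by positivity),
          ← ENNReal.ofReal_add (by positivity) (mul_nonneg (by positivity) (Finset.sum_nonneg fun Q _ => sq_nonneg _))]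
        apply ENNReal.ofReal_le_ofReal
        simp only [Set.mem_preimage, Set.mem_singleton_iff]
        generalize ha : (fun Q => (((Finset.univ.filter fun k => c (q.1 (q.2.1 k)) = Q).card : ℝ) -
        ((Finset.univ.filter fun k => c (q.2.2 k) = Q).card : ℝ))) = a
        have ha' : ∀ Q, (((Finset.univ.filter fun k => c (q.1 (q.2.1 k)) = Q).card : ℝ) -
        ((Finset.univ.filter fun k => c (q.2.2 k) = Q).card : ℝ)) = a Q := fun Q => by rw [← ha]
        simp only [ha']
        calc ∑ Q ∈ S, |a Q| ≤ ∑ Q ∈ S, (s / 2 + 1 / (2 * s) * a Q ^ 2) := by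
              refine Finset.sum_le_sum fun Q _ => ?_
              have : s / 2 + 1 / (2 * s) * a Q ^ 2 - |a Q| = (s - |a Q|)^2 / (2 * s) := by
                rw [← sq_abs (a Q)]; field_simp; ring
              have h2 : 0 ≤ (s - |a Q|)^2 / (2 * s) := by positivity
              linarith
          _ = S.card * (s / 2) + 1 / (2 * s) * ∑ Q ∈ S, a Q ^ 2 := by
              rw [Finset.sum_add_distrib, Finset.sum_const, nsmul_eq_mul, Finset.mul_sum]
          _ ≤ K * s / 2 + 1 / (2 * s) * ∑ Q ∈ S, a Q ^ 2 := by
              rw [mul_div_assoc]; gcongr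
    _ ≤ ENNReal.ofReal (K * s / 2) + ENNReal.ofReal (1 / (2 * s)) * ∑ Q ∈ S, ENNReal.ofReal (9 * n * F.real (c ⁻¹' {Q})) := by
        rw [lintegral_add_left measurable_const, lintegral_const, measure_univ, mul_one,
          lintegral_const_mul' _ _ ENNReal.ofReal_ne_top, lintegral_finsetSum]
        · gcongr with Q hQ
          exact one_cell hn F _ (hmQ Q)
        · intro Q _
          exact meas_diff_sq _ (hmQ Q)
    _ = ENNReal.ofReal (K * s / 2 + 1 / (2 * s) * (9 * n * ∑ Q ∈ S, F.real (c ⁻¹' {Q}))) := by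
        rw [← ENNReal.ofReal_sum_of_nonneg (fun Q _ => by positivity), ← ENNReal.ofReal_mul (by positivity),
          ← ENNReal.ofReal_add (by positivity) (by positivity), ← Finset.mul_sum]
    _ ≤ _ := by
        apply ENNReal.ofReal_le_ofReal
        have h1 : Real.sqrt (n * K) = K * s := by
          rw [show (n * K : ℝ) = (K * s)^2 by rw [mul_pow, pow_two s, hss]; field_simp]
          exact Real.sqrt_sq (by positivity)
        have h2 : (n:ℝ) = K * s * s := by rw [mul_assoc, hss]; field_simp
        calc _ ≤ K * s / 2 + 1 / (2 * s) * (9 * n * 1) := by gcongr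
          _ = 5 * (K * s) := by
            rw [h2]; field_simp; ring
          _ = _ := by rw [h1]

/-- Coarsening of a cell index of level `L` to level `l`. -/
def coarse {d : ℕ} (L l : ℕ) (C : Fin d → ℤ) : Fin d → ℤ := fun i => C i / 2 ^ (L - l)

lemma coarse_nest {d : ℕ} (L l : ℕ) (C D : Fin d → ℤ) (h : coarse L (l+1) C = coarse L (l+1) D) :
    coarse L l C = coarse L l D := by
  ext i
  have h1 := congrFun h i
  simp only [coarse] at h1 ⊢
  by_cases hl : l + 1 ≤ L
  · have : L - l = (L - (l+1)) + 1 := by omega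
    rw [this, pow_succ, ← Int.ediv_ediv_of_nonneg (by positivity), ← Int.ediv_ediv_of_nonneg (by positivity), h1]
  · have h2 : L - l = L - (l + 1) := by omega
    rw [h2, h1]

lemma coarse_cell {d : ℕ} (L l : ℕ) (h : l ≤ L) (x : Fin d → ℝ) :
    coarse L l (cellOf L x) = cellOf l x := by
  ext i
  simp only [coarse, cellOf]
  have e : (2:ℝ) ^ l * x i = (2 ^ L * x i) / ((2 ^ (L - l) : ℕ) : ℝ) := by
    push_cast
    rw [eq_div_iff (by positivity), mul_right_comm, ← pow_add, Nat.add_sub_cancel' h]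
  rw [e, Int.floor_div_natCast]
  push_cast
  rfl

/-- The matching permutation. -/
def sigmaP {d n : ℕ} (L : ℕ) (C D : Fin n → Fin d → ℤ) : Equiv.Perm (Fin n) :=
  Classical.choose (exists_matching L (fun l k => coarse L l (C k)) (fun l k => coarse L l (D k))
    (fun l k m h => coarse_nest L l (C k) (D m) h))

lemma sigmaP_spec {d n : ℕ} (L : ℕ) (X Z : Fin n → Fin d → ℝ) (l : ℕ) (hl : l ≤ L)
    (S : Finset (Fin d → ℤ)) (hS : ∀ k, cellOf l (X k) ∈ S) :
    ((Finset.univ.filter fun k => cellOf l (X k) ≠ cellOf l (Z (sigmaP L (fun k => cellOf L (X k))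
      (fun k => cellOf L (Z k)) k))).card : ℝ) ≤
      ∑ Q ∈ S, |((Finset.univ.filter fun k => cellOf l (X k) = Q).card : ℝ) -
        ((Finset.univ.filter fun k => cellOf l (Z k) = Q).card : ℝ)| := by
  have h := Classical.choose_spec (exists_matching L (fun l k => coarse L l (cellOf L (X k)))
    (fun l k => coarse L l (cellOf L (Z k)))
    (fun l k m h => coarse_nest L l (cellOf L (X k)) (cellOf L (Z m)) h)) l hl S
  simp only [coarse_cell L l hl] at h
  exact h hS

lemma msupport_ae {d : ℕ} (F : Measure (Fin d → ℝ)) : ∀ᵐ x ∂F, x ∈ msupport F := by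
  have h : msupport F = F.support := by
    ext x
    simp only [msupport, Set.mem_ofPred_eq]
    rw [Measure.mem_support_iff_forall]
    constructor
    · intro h U hU
      obtain ⟨V, hV, hVo, hx⟩ := mem_nhds_iff.1 hU
      exact (h V hVo hx).trans_le (measure_mono hV)
    · intro h U hU hx
      exact h U (hU.mem_nhds hx)
  rw [h]
  exact Measure.measure_compl_support

lemma msupport_pi_ae {d : ℕ} (n : ℕ) (F : Measure (Fin d → ℝ)) [IsProbabilityMeasure F] :
    ∀ᵐ X ∂(Measure.pi fun _ : Fin n => F), ∀ k, X k ∈ msupport F :=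
  Filter.eventually_all.2 fun k =>
    (measurePreserving_eval (fun _ : Fin n => F) k).quasiMeasurePreserving.ae (msupport_ae F)

lemma coord_le {d : ℕ} (F : Measure (Fin d → ℝ)) (hF : InnerProductDistribution d F)
    (x : Fin d → ℝ) (hx : x ∈ msupport F) (i : Fin d) : |x i| ≤ 1 := by
  have h := (hF.2 x hx x hx).2
  simp only [dotd, ← pow_two] at h
  have : x i ^ 2 ≤ 1 := (Finset.single_le_sum (fun j _ => sq_nonneg (x j)) (Finset.mem_univ i)).trans h
  exact (sq_le_one_iff_abs_le_one _).1 this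

/-- Majorant of the sup distance. -/
def mism {d : ℕ} (L : ℕ) (x y : Fin d → ℝ) : ℝ := (1/2) ^ L + ∑ l ∈ Finset.range (L+1),
      2 * (1/2) ^ l * (if cellOf l x ≠ cellOf l y then (1:ℝ) else 0)

lemma mism_nonneg {d : ℕ} (L : ℕ) (x y : Fin d → ℝ) : 0 ≤ mism L x y := by
  unfold mism
  refine add_nonneg (by positivity) (Finset.sum_nonneg fun l _ => by positivity)

set_option maxHeartbeats 1000000 in
lemma mism_int {d n : ℕ} (hn : 0 < n) (F : Measure (Fin d → ℝ)) [IsProbabilityMeasure F]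
    (hF : InnerProductDistribution d F) (L : ℕ) :
    ∫⁻ q : (Fin n → Fin d → ℝ) × (Fin n → Fin n) × (Fin n → Fin d → ℝ), ENNReal.ofReal
      (∑ k, mism L (q.1 (q.2.1 k)) (q.2.2 (sigmaP L (fun k => cellOf L (q.1 (q.2.1 k)))
        (fun k => cellOf L (q.2.2 k)) k)))
      ∂((Measure.pi fun _ => F).prod ((Measure.pi fun _ => uniformFin n).prod (Measure.pi fun _ => F)))
      ≤ ENNReal.ofReal (n * (1/2) ^ L + ∑ l ∈ Finset.range (L+1),
        2 * (1/2) ^ l * (5 * Real.sqrt (n * (3 * 2 ^ l) ^ d))) := by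
  have := uniformFin_prob hn
  have hae : ∀ᵐ q ∂((Measure.pi fun _ : Fin n => F).prod ((Measure.pi fun _ : Fin n => uniformFin n).prod (Measure.pi fun _ : Fin n => F))),
      ∀ k, q.1 k ∈ msupport F :=
    measurePreserving_fst.quasiMeasurePreserving.ae (msupport_pi_ae n F)
  have hm : ∀ l, Measurable fun q : (Fin n → Fin d → ℝ) × (Fin n → Fin n) × (Fin n → Fin d → ℝ) =>
      ENNReal.ofReal (∑ Q ∈ cellSet d l, |((Finset.univ.filter fun k => cellOf l (q.1 (q.2.1 k)) = Q).card : ℝ) -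
        ((Finset.univ.filter fun k => cellOf l (q.2.2 k) = Q).card : ℝ)|) := by
    intro l
    refine (Finset.measurable_sum _ fun Q _ => ?_).ennreal_ofReal
    have hS : MeasurableSet (cellOf (d := d) l ⁻¹' {Q}) := measurable_cellOf l (measurableSet_singleton Q)
    have h1 := meas_count n (fun k (q : (Fin n → Fin d → ℝ) × (Fin n → Fin n) × (Fin n → Fin d → ℝ)) =>
      q.1 (q.2.1 k)) meas_ev _ hS
    have h2 := meas_count n (fun k (q : (Fin n → Fin d → ℝ) × (Fin n → Fin n) × (Fin n → Fin d → ℝ)) =>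
      q.2.2 k) (fun k => (measurable_pi_apply k).comp (measurable_snd.comp measurable_snd)) _ hS
    convert (h1.sub h2).norm using 2 with q
    simp only [Pi.sub_apply, Set.mem_preimage, Set.mem_singleton_iff, Real.norm_eq_abs]
  calc _ ≤ ∫⁻ q : (Fin n → Fin d → ℝ) × (Fin n → Fin n) × (Fin n → Fin d → ℝ), (ENNReal.ofReal (n * (1/2) ^ L)
        + ∑ l ∈ Finset.range (L+1), ENNReal.ofReal (2 * (1/2) ^ l) *
      ENNReal.ofReal (∑ Q ∈ cellSet d l, |((Finset.univ.filter fun k => cellOf l (q.1 (q.2.1 k)) = Q).card : ℝ) -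
        ((Finset.univ.filter fun k => cellOf l (q.2.2 k) = Q).card : ℝ)|))
      ∂((Measure.pi fun _ => F).prod ((Measure.pi fun _ => uniformFin n).prod (Measure.pi fun _ => F))) := by
        refine lintegral_mono_ae (hae.mono fun q hq => ?_)
        simp only [← ENNReal.ofReal_mul (show (0:ℝ) ≤ 2 * (1/2) ^ _ by positivity)]
        rw [← ENNReal.ofReal_sum_of_nonneg (fun Q _ => by positivity),
          ← ENNReal.ofReal_add (by positivity) (by positivity)]
        apply ENNReal.ofReal_le_ofReal
        unfold mism
        rw [Finset.sum_add_distrib, Finset.sum_const, Finset.card_univ, Fintype.card_fin, nsmul_eq_mul,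
          Finset.sum_comm]
        gcongr with l hl
        rw [← Finset.mul_sum]
        gcongr
        have := sigmaP_spec L (fun k => q.1 (q.2.1 k)) q.2.2 l (by simp at hl; omega) (cellSet d l)
          (fun k => cell_mem l _ (coord_le F hF _ (hq _)))
        rw [Finset.natCast_card_filter] at this
        exact this
    _ = ENNReal.ofReal (n * (1/2) ^ L) + ∑ l ∈ Finset.range (L+1), ENNReal.ofReal (2 * (1/2) ^ l) *
      ∫⁻ q : (Fin n → Fin d → ℝ) × (Fin n → Fin n) × (Fin n → Fin d → ℝ),
      ENNReal.ofReal (∑ Q ∈ cellSet d l, |((Finset.univ.filter fun k => cellOf l (q.1 (q.2.1 k)) = Q).card : ℝ) -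
        ((Finset.univ.filter fun k => cellOf l (q.2.2 k) = Q).card : ℝ)|)
      ∂((Measure.pi fun _ => F).prod ((Measure.pi fun _ => uniformFin n).prod (Measure.pi fun _ => F))) := by
        rw [lintegral_add_left measurable_const, lintegral_const, measure_univ, mul_one,
          lintegral_finsetSum _ fun l _ => (hm l).const_mul _]
        congr 1
        refine Finset.sum_congr rfl fun l _ => ?_
        rw [lintegral_const_mul _ (hm l)]
    _ ≤ ENNReal.ofReal (n * (1/2) ^ L) + ∑ l ∈ Finset.range (L+1), ENNReal.ofReal (2 * (1/2) ^ l) *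
        ENNReal.ofReal (5 * Real.sqrt (n * (3 * 2 ^ l) ^ d)) := by
        gcongr with l hl
        have h5 := all_cells hn F (cellOf l) (measurable_cellOf l) (cellSet d l) _ (by positivity) (cellSet_card d l)
        refine le_trans (le_of_eq ?_) h5
        congr!
    _ = _ := by
        simp only [← ENNReal.ofReal_mul (show (0:ℝ) ≤ 2 * (1/2) ^ _ by positivity)]
        rw [← ENNReal.ofReal_sum_of_nonneg (fun Q _ => by positivity),
          ← ENNReal.ofReal_add (by positivity) (by positivity)]

/-- The map on ordered pairs induced by a permutation, preserving the order type. -/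
def pairMap {n : ℕ} (τ : Equiv.Perm (Fin n)) (q : Fin n × Fin n) : Fin n × Fin n :=
  if q.1 < q.2 then (min (τ q.1) (τ q.2), max (τ q.1) (τ q.2))
  else (max (τ q.1) (τ q.2), min (τ q.1) (τ q.2))

lemma pairMap_inv {n : ℕ} (τ ρ : Equiv.Perm (Fin n)) (h : ∀ x, ρ (τ x) = x) (q : Fin n × Fin n) :
    pairMap ρ (pairMap τ q) = q := by
  obtain ⟨a, b⟩ := q
  unfold pairMap
  by_cases hab : a < b
  · have hne : τ a ≠ τ b := fun h => hab.ne (τ.injective h)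
    rcases lt_or_gt_of_ne hne with h1 | h1
    · simp [hab, h1, h, h1.le, hab.le]
    · simp [hab, h1, h, h1.le, hab.le]
  · rcases lt_or_eq_of_le (not_lt.1 hab) with hba | hba
    · have hne : τ a ≠ τ b := fun h => hba.ne' (τ.injective h)
      rcases lt_or_gt_of_ne hne with h1 | h1
      · simp [hab, h1, h, h1.le, hba.le, h1.not_gt]
      · simp [hab, h1, h, h1.le, hba.le, h1.not_gt]
    · subst hba; simp [h]

/-- The permutation of ordered pairs induced by a permutation. -/
def pairPerm {n : ℕ} (σ : Equiv.Perm (Fin n)) : Equiv.Perm (Fin n × Fin n) where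
  toFun := pairMap σ.symm
  invFun := pairMap σ
  left_inv := pairMap_inv _ _ (by simp)
  right_inv := pairMap_inv _ _ (by simp)

lemma pairPerm_apply {n : ℕ} (σ : Equiv.Perm (Fin n)) (k l : Fin n) (h : k ≠ l) :
    pairPerm σ (min (σ k) (σ l), max (σ k) (σ l)) = (min k l, max k l) := by
  change pairMap σ.symm _ = _
  have h2 : pairMap σ (min k l, max k l) = (min (σ k) (σ l), max (σ k) (σ l)) := by
    unfold pairMap
    rcases lt_or_gt_of_ne h with h1 | h1
    · simp [h1, h1.le]
    · simp [h1, h1.le, min_comm, max_comm]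
  rw [← h2]
  exact pairMap_inv _ _ (by simp) _

lemma pairUniform_perm {n : ℕ} (e : Equiv.Perm (Fin n × Fin n)) :
    (pairUniform n).map (fun u q => u (e q)) = pairUniform n := by
  have h := Measure.pi_map_piCongrLeft e.symm (β := fun _ : Fin n × Fin n => ℝ)
    (fun _ => (volume : Measure ℝ).restrict (Set.Icc (0:ℝ) 1))
  unfold pairUniform
  convert h using 2
  ext u q
  obtain ⟨q', rfl⟩ := e.symm.surjective q
  rw [MeasurableEquiv.coe_piCongrLeft, Equiv.piCongrLeft_apply_apply]
  simp

lemma relabel_mp {n : ℕ} {R K : Type*} [MeasurableSpace R] [MeasurableSpace K] [Countable K]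
    [MeasurableSingletonClass K] (ρ : Measure R) [IsProbabilityMeasure ρ] (C : R → K)
    (hC : Measurable C) (e : K → Equiv.Perm (Fin n × Fin n)) :
    MeasurePreserving (fun p : R × (Fin n × Fin n → ℝ) => (p.1, fun q => p.2 (e (C p.1) q)))
      (ρ.prod (pairUniform n)) (ρ.prod (pairUniform n)) := by
  refine MeasurePreserving.skew_product (g := fun (r : R) (u : Fin n × Fin n → ℝ) (q : Fin n × Fin n) => u (e (C r) q)) (MeasurePreserving.id ρ) ?_
    (Filter.Eventually.of_forall fun r => pairUniform_perm _)
  have h1 : Measurable fun p : K × (Fin n × Fin n → ℝ) => fun q => p.2 (e p.1 q) :=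
    measurable_from_prod_countable_right fun k =>
      measurable_pi_lambda _ fun q => measurable_pi_apply (e k q)
  exact h1.comp ((hC.comp measurable_fst).prodMk measurable_snd)

lemma meas_dotd {d : ℕ} {Ω : Type*} [MeasurableSpace Ω] {f g : Ω → Fin d → ℝ} (hf : Measurable f)
    (hg : Measurable g) : Measurable fun ω => dotd (f ω) (g ω) := by
  unfold dotd
  exact Finset.measurable_sum _ fun k _ =>
    ((measurable_pi_apply k).comp hf).mul ((measurable_pi_apply k).comp hg)

lemma meas_adjOf {d n : ℕ} {Ω : Type*} [MeasurableSpace Ω] {X : Ω → Fin n → Fin d → ℝ}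
    {u : Ω → Fin n × Fin n → ℝ} (hX : Measurable X) (hu : Measurable u) :
    Measurable fun ω => adjOf 1 (X ω) (u ω) := by
  refine measurable_pi_lambda _ fun i => measurable_pi_lambda _ fun j => ?_
  unfold adjOf
  by_cases hij : i = j
  · simp [hij]
  · simp only [hij, if_false]
    refine Measurable.ite (measurableSet_lt ((measurable_pi_apply _).comp hu) ?_)
      measurable_const measurable_const
    exact (meas_dotd ((measurable_pi_apply i).comp hX) ((measurable_pi_apply j).comp hX)).const_mul 1

/-- Rounding of a matrix to zero-one entries. -/
def rnd {n : ℕ} (a : Fin n → Fin n → ℝ) : Fin n → Fin n → ℝ := fun i j => if a i j = 1 then 1 else 0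

lemma rnd_adj {d n : ℕ} (X : Fin n → Fin d → ℝ) (u : Fin n × Fin n → ℝ) :
    rnd (adjOf 1 X u) = adjOf 1 X u := by
  ext i j
  unfold rnd adjOf
  split_ifs <;> simp_all

lemma meas_rnd {n : ℕ} {β : Type*} [MeasurableSpace β] (g : (Fin n → Fin n → ℝ) → β) :
    Measurable fun a => g (rnd a) := by
  have h1 : Measurable fun (a : Fin n → Fin n → ℝ) => fun i j => decide (a i j = 1) := by
    refine measurable_pi_lambda _ fun i => measurable_pi_lambda _ fun j => ?_
    have h2 : Measurable fun (a : Fin n → Fin n → ℝ) => a i j :=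
      (measurable_pi_apply j).comp (measurable_pi_apply i)
    refine measurable_to_bool ?_
    have : ((fun (a : Fin n → Fin n → ℝ) => decide (a i j = 1)) ⁻¹' {true}) = {a | a i j = 1} := by
      ext a; simp
    rw [this]
    exact h2 (measurableSet_singleton 1)
  have h3 : Measurable fun (b : Fin n → Fin n → Bool) =>
      g (fun i j => if b i j = true then 1 else 0) := measurable_of_countable _
  have h4 := h3.comp h1
  convert h4 using 2 with a
  simp only [Function.comp, rnd]
  congr 1
  ext i j
  simp [rnd]

lemma meas_of_adj {d n : ℕ} {Ω β : Type*} [MeasurableSpace Ω] [MeasurableSpace β] {X : Ω → Fin n → Fin d → ℝ}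
    {u : Ω → Fin n × Fin n → ℝ} (hX : Measurable X) (hu : Measurable u)
    (g : (Fin n → Fin n → ℝ) → β) : Measurable fun ω => g (adjOf 1 (X ω) (u ω)) := by
  have := (meas_rnd g).comp (meas_adjOf hX hu)
  simpa only [Function.comp_def, rnd_adj] using this

lemma adjLaw_eq {d n : ℕ} (F : Measure (Fin d → ℝ)) [SigmaFinite F] :
    adjLaw d n F = Measure.map (fun p => adjOf 1 p.2 p.1)
      ((pairUniform n).prod (Measure.pi fun _ : Fin n => F)) := by
  unfold adjLaw rdpgLaw rdpgLawOf
  rw [Measure.map_map measurable_fst]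
  · rfl
  · exact (meas_adjOf measurable_snd measurable_fst).prodMk measurable_snd

lemma emp_eq {d n : ℕ} (Y : Fin n → Fin d → ℝ) : empMeasure Y = (uniformFin n).map Y := by
  ext s hs
  rw [Measure.map_apply (measurable_of_countable _) hs]
  simp only [empMeasure, uniformFin, Measure.smul_apply, Measure.finsetSum_apply]
  congr 1
  rw [Measure.count_apply ((Set.toFinite _).measurableSet)]
  simp only [Measure.dirac_apply' _ hs, Set.indicator, Pi.one_apply]
  rw [Finset.sum_boole, Set.encard_eq_coe_toFinset_card]
  simp only [ENat.toENNReal_coe]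
  congr 2
  ext i; simp

lemma boot_fixed {d n : ℕ} (hn : 0 < n) (Y : Fin n → Fin d → ℝ) :
    adjLaw d n (empMeasure Y) = Measure.map (fun p : (Fin n → Fin n) × (Fin n × Fin n → ℝ) =>
      adjOf 1 (fun k => Y (p.1 k)) p.2) ((Measure.pi fun _ : Fin n => uniformFin n).prod (pairUniform n)) := by
  have := uniformFin_prob hn
  have hY : Measurable Y := measurable_of_countable _
  have : IsProbabilityMeasure ((uniformFin n).map Y) := Measure.isProbabilityMeasure_map hY.aemeasurable
  rw [adjLaw_eq, emp_eq, ← Measure.pi_map_pi (fun _ => hY.aemeasurable)]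
  rw [← Measure.prod_swap, Measure.map_map]
  · have h2 : (Measure.map (fun x i => Y (x i)) (Measure.pi fun _ : Fin n => uniformFin n)).prod (pairUniform n) =
      Measure.map (Prod.map (fun (x : Fin n → Fin n) i => Y (x i)) id) ((Measure.pi fun _ : Fin n => uniformFin n).prod (pairUniform n)) := by
      rw [← Measure.map_prod_map _ _ (measurable_of_countable _) measurable_id, Measure.map_id]
    rw [h2, Measure.map_map]
    · rfl
    · exact (meas_adjOf measurable_snd measurable_fst).comp measurable_swap
    · exact (measurable_of_countable _).prodMap measurable_id
  · exact meas_adjOf measurable_snd measurable_fst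
  · exact measurable_swap

/-- The sample space of the latent data. -/
abbrev RSp (d n : ℕ) : Type :=
  ((Fin n × Fin n → ℝ) × (Fin n → Fin d → ℝ)) × ((Fin n → Fin n) × (Fin n → Fin d → ℝ))

/-- The law of the latent data. -/
def baseM {d : ℕ} (n : ℕ) (F : Measure (Fin d → ℝ)) [SigmaFinite F] : Measure (RSp d n) :=
  ((pairUniform n).prod (Measure.pi fun _ : Fin n => F)).prod
    ((Measure.pi fun _ : Fin n => uniformFin n).prod (Measure.pi fun _ : Fin n => F))

/-- Matching permutation as a function of the data. -/
def sig {d n : ℕ} (L : ℕ) (r : RSp d n) : Equiv.Perm (Fin n) :=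
  sigmaP L (fun k => cellOf L (r.1.2 (r.2.1 k))) (fun k => cellOf L (r.2.2 k))

/-- Bootstrapped positions. -/
def bootY {d n : ℕ} (r : RSp d n) : Fin n → Fin d → ℝ :=
  fun k => ase d (adjOf 1 r.1.2 r.1.1) (r.2.1 k)

/-- Bootstrapped graph. -/
def cplA {d n : ℕ} (p : RSp d n × (Fin n × Fin n → ℝ)) : Fin n → Fin n → ℝ :=
  adjOf 1 (bootY p.1) p.2

/-- Coupled graph. -/
def cplH {d n : ℕ} (L : ℕ) (p : RSp d n × (Fin n × Fin n → ℝ)) : Fin n → Fin n → ℝ :=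
  adjOf 1 p.1.2.2 (fun q => p.2 (pairPerm (sig L p.1) q))

lemma meas_sel {Ω α : Type*} [MeasurableSpace Ω] [MeasurableSpace α] {n : ℕ} {f : Ω → Fin n → α}
    {I : Ω → Fin n} (hf : Measurable f) (hI : Measurable I) : Measurable fun ω => f ω (I ω) := by
  have h1 : Measurable fun p : (Fin n → α) × Fin n => p.1 p.2 :=
    measurable_from_prod_countable_left fun i => measurable_pi_apply i
  exact h1.comp (hf.prodMk hI)

lemma meas_bootY {d n : ℕ} : Measurable (bootY : RSp d n → _) := by
  refine measurable_pi_lambda _ fun k => ?_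
  unfold bootY
  refine meas_sel (f := fun r : RSp d n => ase d (adjOf 1 r.1.2 r.1.1)) ?_ ?_
  · exact meas_of_adj (X := fun r : RSp d n => r.1.2) (u := fun r : RSp d n => r.1.1)
      (measurable_snd.comp measurable_fst) (measurable_fst.comp measurable_fst) (ase d)
  · exact (measurable_pi_apply k).comp (measurable_fst.comp measurable_snd)

lemma meas_cplA {d n : ℕ} : Measurable (cplA : RSp d n × _ → _) :=
  meas_adjOf (meas_bootY.comp measurable_fst) measurable_snd

lemma meas_XI {d n : ℕ} (k : Fin n) : Measurable fun r : RSp d n => r.1.2 (r.2.1 k) :=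
  meas_sel (f := fun r : RSp d n => r.1.2) (measurable_snd.comp measurable_fst)
    ((measurable_pi_apply k).comp (measurable_fst.comp measurable_snd))

lemma meas_Z {d n : ℕ} (k : Fin n) : Measurable fun r : RSp d n => r.2.2 k :=
  (measurable_pi_apply k).comp (measurable_snd.comp measurable_snd)

instance pairUniform_fin (n : ℕ) : SigmaFinite (pairUniform n) := by
  unfold pairUniform; infer_instance

lemma baseM_prob {d n : ℕ} (hn : 0 < n) (F : Measure (Fin d → ℝ)) [IsProbabilityMeasure F] :
    IsProbabilityMeasure (baseM n F) := by
  have := uniformFin_prob hn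
  unfold baseM; infer_instance

lemma sig_mp {d n : ℕ} (hn : 0 < n) (L : ℕ) (F : Measure (Fin d → ℝ)) [IsProbabilityMeasure F] :
    MeasurePreserving (fun p : RSp d n × (Fin n × Fin n → ℝ) =>
      (p.1, fun q => p.2 (pairPerm (sig L p.1) q)))
      ((baseM n F).prod (pairUniform n)) ((baseM n F).prod (pairUniform n)) := by
  have := baseM_prob hn F
  refine relabel_mp (K := (Fin n → Fin d → ℤ) × (Fin n → Fin d → ℤ)) (baseM n F)
    (fun r => (fun k => cellOf L (r.1.2 (r.2.1 k)), fun k => cellOf L (r.2.2 k))) ?_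
    (fun c => pairPerm (sigmaP L c.1 c.2))
  refine Measurable.prodMk ?_ ?_
  · exact measurable_pi_lambda _ fun k => (measurable_cellOf L).comp (meas_XI k)
  · exact measurable_pi_lambda _ fun k => (measurable_cellOf L).comp (meas_Z k)

lemma meas_H0 {d n : ℕ} : Measurable (fun p : RSp d n × (Fin n × Fin n → ℝ) => adjOf 1 p.1.2.2 p.2) :=
  meas_adjOf (measurable_snd.comp (measurable_snd.comp measurable_fst)) measurable_snd

lemma meas_cplH {d n : ℕ} (hn : 0 < n) (L : ℕ) (F : Measure (Fin d → ℝ)) [IsProbabilityMeasure F] :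
    Measurable (cplH L : RSp d n × _ → _) :=
  meas_H0.comp (sig_mp hn L F).measurable

lemma map_cplH {d n : ℕ} (hn : 0 < n) (L : ℕ) (F : Measure (Fin d → ℝ)) [IsProbabilityMeasure F] :
    ((baseM n F).prod (pairUniform n)).map (cplH L) = adjLaw d n F := by
  have := baseM_prob hn F
  have := uniformFin_prob hn
  have h1 : (cplH L : RSp d n × _ → _) = (fun p : RSp d n × (Fin n × Fin n → ℝ) => adjOf 1 p.1.2.2 p.2) ∘
    (fun p : RSp d n × (Fin n × Fin n → ℝ) => (p.1, fun q => p.2 (pairPerm (sig L p.1) q))) := rfl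
  rw [h1, ← Measure.map_map meas_H0 (sig_mp hn L F).measurable, (sig_mp hn L F).map_eq, adjLaw_eq]
  have h2 : MeasurePreserving (fun r : RSp d n => r.2.2) (baseM n F) (Measure.pi fun _ : Fin n => F) :=
    measurePreserving_snd.comp measurePreserving_snd
  have h3 := h2.prod (MeasurePreserving.id (pairUniform n))
  have h4 := Measure.measurePreserving_swap.comp h3
  rw [← h4.map_eq, Measure.map_map (meas_adjOf measurable_snd measurable_fst) h4.measurable]
  rfl

lemma map_cplA {d n : ℕ} (hn : 0 < n) (F : Measure (Fin d → ℝ)) [IsProbabilityMeasure F] :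
    ((baseM n F).prod (pairUniform n)).map cplA = bootLaw d n F := by
  have := uniformFin_prob hn
  set kk : (Fin n → Fin n → ℝ) → Measure (Fin n → Fin n → ℝ) :=
    fun a => adjLaw d n (empMeasure (ase d a)) with hkk
  have hadj : Measurable fun p : (Fin n × Fin n → ℝ) × (Fin n → Fin d → ℝ) => adjOf 1 p.2 p.1 :=
    meas_adjOf measurable_snd measurable_fst
  have hae : ∀ᵐ a ∂(adjLaw d n F), rnd a = a := by
    rw [adjLaw_eq, ae_map_iff hadj.aemeasurable]
    · exact Filter.Eventually.of_forall fun p => rnd_adj _ _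
    · exact measurableSet_eq_fun (meas_rnd id) measurable_id
  have hkm : AEMeasurable kk (adjLaw d n F) :=
    (meas_rnd kk).aemeasurable.congr (hae.mono fun a ha => by simp only [ha])
  ext s hs
  unfold bootLaw
  rw [Measure.bind_apply hs hkm]
  change _ = ∫⁻ a, kk a s ∂(adjLaw d n F)
  have e1 : ∫⁻ a, kk a s ∂(adjLaw d n F) = ∫⁻ a, kk (rnd a) s ∂(adjLaw d n F) :=
    lintegral_congr_ae (hae.mono fun a ha => by simp only [ha])
  rw [e1, adjLaw_eq, lintegral_map (meas_rnd fun a => kk a s) hadj]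
  simp only [rnd_adj]
  set B := (pairUniform n).prod (Measure.pi fun _ : Fin n => F) with hB
  set J := (Measure.pi fun _ : Fin n => uniformFin n) with hJ
  set ZZ := (Measure.pi fun _ : Fin n => F) with hZ
  have hmp : MeasurePreserving (fun p : RSp d n × (Fin n × Fin n → ℝ) => (p.1.1, (p.1.2.1, p.2)))
      ((baseM n F).prod (pairUniform n)) (B.prod (J.prod (pairUniform n))) := by
    have a1 : MeasurePreserving MeasurableEquiv.prodAssoc ((B.prod (J.prod ZZ)).prod (pairUniform n))
      (B.prod ((J.prod ZZ).prod (pairUniform n))) := measurePreserving_prodAssoc _ _ _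
    have a2 : MeasurePreserving Prod.fst (J.prod ZZ) J := measurePreserving_fst
    have a3 := (MeasurePreserving.id B).prod (a2.prod (MeasurePreserving.id (pairUniform n)))
    exact a3.comp a1
  set G : ((Fin n × Fin n → ℝ) × (Fin n → Fin d → ℝ)) × ((Fin n → Fin n) × (Fin n × Fin n → ℝ)) → Fin n → Fin n → ℝ :=
    fun t => adjOf 1 (fun k => ase d (adjOf 1 t.1.2 t.1.1) (t.2.1 k)) t.2.2 with hG
  have hGm : Measurable G := by
    refine meas_adjOf ?_ (measurable_snd.comp measurable_snd)
    refine measurable_pi_lambda _ fun k => ?_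
    refine meas_sel (f := fun t : ((Fin n × Fin n → ℝ) × (Fin n → Fin d → ℝ)) × ((Fin n → Fin n) × (Fin n × Fin n → ℝ))
      => ase d (adjOf 1 t.1.2 t.1.1)) ?_ ?_
    · exact meas_of_adj (X := fun t : ((Fin n × Fin n → ℝ) × (Fin n → Fin d → ℝ)) × ((Fin n → Fin n) × (Fin n × Fin n → ℝ)) => t.1.2)
        (u := fun t => t.1.1)
        (measurable_snd.comp measurable_fst) (measurable_fst.comp measurable_fst) (ase d)
    · exact (measurable_pi_apply k).comp (measurable_fst.comp measurable_snd)
  have e2 : (cplA : RSp d n × _ → _) = G ∘ (fun p : RSp d n × (Fin n × Fin n → ℝ) => (p.1.1, (p.1.2.1, p.2))) := rfl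
  rw [e2, ← Measure.map_map hGm hmp.measurable, hmp.map_eq, Measure.map_apply hGm hs,
    Measure.prod_apply (hGm hs)]
  refine lintegral_congr fun b => ?_
  simp only [hkk]
  rw [boot_fixed hn, Measure.map_apply ?_ hs]
  · rfl
  · exact hGm.comp measurable_prodMk_left

lemma ind_diff {n : ℕ} (q : Fin n × Fin n) (a b : ℝ) :
    ∫⁻ u, ENNReal.ofReal |(if u q < a then (1:ℝ) else 0) - (if u q < b then 1 else 0)| ∂(pairUniform n)
      ≤ ENNReal.ofReal |a - b| := by
  have : IsProbabilityMeasure ((volume : Measure ℝ).restrict (Set.Icc (0:ℝ) 1)) := unif_prob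
  have hmp : MeasurePreserving (Function.eval q) (pairUniform n) ((volume : Measure ℝ).restrict (Set.Icc (0:ℝ) 1)) :=
    measurePreserving_eval (fun _ : Fin n × Fin n => (volume : Measure ℝ).restrict (Set.Icc (0:ℝ) 1)) q
  have hm : Measurable fun x : ℝ => ENNReal.ofReal |(if x < a then (1:ℝ) else 0) - (if x < b then 1 else 0)| := by
    have h1 : ∀ c : ℝ, Measurable fun x : ℝ => (if x < c then (1:ℝ) else 0) := fun c =>
      Measurable.ite measurableSet_Iio measurable_const measurable_const
    exact ((h1 a).sub (h1 b)).norm.ennreal_ofReal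
  have h := hmp.lintegral_comp hm
  refine (le_of_eq h).trans ?_
  calc _ ≤ ∫⁻ x, (Set.Ico (min a b) (max a b)).indicator 1 x ∂((volume : Measure ℝ).restrict (Set.Icc (0:ℝ) 1)) := by
        refine lintegral_mono fun x => ?_
        simp only [Set.indicator, Set.mem_Ico, min_le_iff, lt_max_iff, Pi.one_apply]
        clear h
        by_cases h1 : x < a <;> by_cases h2 : x < b
        · simp [h1, h2]
        · simp [h1, h2, not_lt.1 h2]
        · simp [h1, h2, not_lt.1 h1]
        · simp [h1, h2]
    _ = ((volume : Measure ℝ).restrict (Set.Icc (0:ℝ) 1)) (Set.Ico (min a b) (max a b)) :=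
        lintegral_indicator_one measurableSet_Ico
    _ ≤ volume (Set.Ico (min a b) (max a b)) := Measure.restrict_apply_le _ _
    _ = _ := by rw [Real.volume_Ico, max_sub_min_eq_abs']

/-- The matched edge discrepancy. -/
def cost {d n : ℕ} (L : ℕ) (p : RSp d n × (Fin n × Fin n → ℝ)) : ℝ :=
  ∑ k, ∑ l, |cplA p k l - cplH L p (sig L p.1 k) (sig L p.1 l)|

/-- The matched probability discrepancy. -/
def pdis {d n : ℕ} (L : ℕ) (r : RSp d n) : ℝ :=
  ∑ k, ∑ l, if k = l then 0 else |dotd (bootY r k) (bootY r l) -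
    dotd (r.2.2 (sig L r k)) (r.2.2 (sig L r l))|

lemma cost_inner {d n : ℕ} (L : ℕ) (r : RSp d n) :
    ∫⁻ u, ENNReal.ofReal (cost L (r, u)) ∂(pairUniform n) ≤ ENNReal.ofReal (pdis L r) := by
  have hterm : ∀ (k l : Fin n) (u : Fin n × Fin n → ℝ),
      |cplA (r,u) k l - cplH L (r,u) (sig L r k) (sig L r l)| = if k = l then 0 else
        |(if u (min k l, max k l) < dotd (bootY r k) (bootY r l) then (1:ℝ) else 0) -
         (if u (min k l, max k l) < dotd (r.2.2 (sig L r k)) (r.2.2 (sig L r l)) then 1 else 0)| := by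
    intro k l u
    by_cases hkl : k = l
    · simp [hkl, cplA, cplH, adjOf]
    · have h2 : sig L r k ≠ sig L r l := fun h => hkl ((sig L r).injective h)
      simp only [cplA, cplH, adjOf, hkl, h2, if_false, one_mul, pairPerm_apply _ _ _ hkl]
  have hm : ∀ k l : Fin n, Measurable fun u : Fin n × Fin n → ℝ => ENNReal.ofReal (if k = l then 0 else
        |(if u (min k l, max k l) < dotd (bootY r k) (bootY r l) then (1:ℝ) else 0) -
         (if u (min k l, max k l) < dotd (r.2.2 (sig L r k)) (r.2.2 (sig L r l)) then 1 else 0)|) := by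
    intro k l
    refine Measurable.ennreal_ofReal ?_
    by_cases hkl : k = l
    · simp [hkl]
    · simp only [hkl, if_false]
      have h1 : ∀ c : ℝ, Measurable fun u : Fin n × Fin n → ℝ => (if u (min k l, max k l) < c then (1:ℝ) else 0) := fun c =>
        Measurable.ite (measurableSet_lt (measurable_pi_apply _) measurable_const) measurable_const measurable_const
      exact ((h1 _).sub (h1 _)).norm
  unfold cost pdis
  simp only [hterm]
  have e1 : ∀ u : Fin n × Fin n → ℝ, ENNReal.ofReal (∑ k, ∑ l, if k = l then 0 else
        |(if u (min k l, max k l) < dotd (bootY r k) (bootY r l) then (1:ℝ) else 0) -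
         (if u (min k l, max k l) < dotd (r.2.2 (sig L r k)) (r.2.2 (sig L r l)) then 1 else 0)|)
      = ∑ k, ∑ l, ENNReal.ofReal (if k = l then 0 else
        |(if u (min k l, max k l) < dotd (bootY r k) (bootY r l) then (1:ℝ) else 0) -
         (if u (min k l, max k l) < dotd (r.2.2 (sig L r k)) (r.2.2 (sig L r l)) then 1 else 0)|) := by
    intro u
    rw [ENNReal.ofReal_sum_of_nonneg]
    · refine Finset.sum_congr rfl fun k _ => ?_
      rw [ENNReal.ofReal_sum_of_nonneg]
      intro l _; split_ifs <;> positivity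
    · intro k _
      refine Finset.sum_nonneg fun l _ => ?_
      split_ifs <;> positivity
  simp only [e1]
  rw [lintegral_finsetSum _ fun k _ => Finset.measurable_sum _ fun l _ => hm k l]
  rw [ENNReal.ofReal_sum_of_nonneg (fun k _ => Finset.sum_nonneg fun l _ => by split_ifs <;> positivity)]
  refine Finset.sum_le_sum fun k _ => ?_
  rw [lintegral_finsetSum _ fun l _ => hm k l]
  rw [ENNReal.ofReal_sum_of_nonneg (fun l _ => by split_ifs <;> positivity)]
  refine Finset.sum_le_sum fun l _ => ?_
  by_cases hkl : k = l
  · simp [hkl]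
  · simp only [hkl, if_false]
    exact ind_diff _ _ _

/-- The embedding error. -/
def gerr {d n : ℕ} (b : (Fin n × Fin n → ℝ) × (Fin n → Fin d → ℝ)) (i j : Fin n) : ℝ :=
  |dotd (ase d (adjOf 1 b.2 b.1) i) (ase d (adjOf 1 b.2 b.1) j) - dotd (b.2 i) (b.2 j)|

/-- Total mismatch. -/
def mtot {d n : ℕ} (L : ℕ) (q : (Fin n → Fin d → ℝ) × (Fin n → Fin n) × (Fin n → Fin d → ℝ)) : ℝ :=
  ∑ k, mism L (q.1 (q.2.1 k)) (q.2.2 (sigmaP L (fun k => cellOf L (q.1 (q.2.1 k)))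
        (fun k => cellOf L (q.2.2 k)) k))

lemma dot_diff {d : ℕ} (x y z w : Fin d → ℝ) (s t : ℝ) (hy : ∀ i, |y i| ≤ 1) (hz : ∀ i, |z i| ≤ 1)
    (h1 : ∀ i, |x i - z i| ≤ s) (h2 : ∀ i, |y i - w i| ≤ t) :
    |dotd x y - dotd z w| ≤ d * (s + t) := by
  unfold dotd
  rw [← Finset.sum_sub_distrib]
  refine (Finset.abs_sum_le_sum_abs _ _).trans ?_
  calc _ ≤ ∑ i : Fin d, (s + t) := by
        refine Finset.sum_le_sum fun i _ => ?_
        have e : x i * y i - z i * w i = (x i - z i) * y i + z i * (y i - w i) := by ring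
        rw [e]
        refine (abs_add_le _ _).trans ?_
        rw [abs_mul, abs_mul]
        refine add_le_add ?_ ?_
        · exact (mul_le_of_le_one_right (abs_nonneg _) (hy i)).trans (h1 i)
        · exact (mul_le_of_le_one_left (abs_nonneg _) (hz i)).trans (h2 i)
    _ = _ := by simp [mul_add]

lemma pdis_le {d n : ℕ} (F : Measure (Fin d → ℝ)) (hF : InnerProductDistribution d F) (L : ℕ) (r : RSp d n)
    (hX : ∀ k, r.1.2 k ∈ msupport F) (hZ : ∀ k, r.2.2 k ∈ msupport F) :
    pdis L r ≤ (∑ k, ∑ l, if k = l then 0 else gerr r.1 (r.2.1 k) (r.2.1 l)) +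
      2 * d * n * mtot L (r.1.2, r.2) := by
  have hx1 : ∀ k i, |r.1.2 k i| ≤ 1 := fun k i => coord_le F hF _ (hX k) i
  have hz1 : ∀ k i, |r.2.2 k i| ≤ 1 := fun k i => coord_le F hF _ (hZ k) i
  set m : Fin n → ℝ := fun k => mism L (r.1.2 (r.2.1 k)) (r.2.2 (sig L r k)) with hm
  have hm0 : ∀ k, 0 ≤ m k := fun k => mism_nonneg _ _ _
  have hmt : mtot L (r.1.2, r.2) = ∑ k, m k := rfl
  have hch : ∀ k i, |r.1.2 (r.2.1 k) i - r.2.2 (sig L r k) i| ≤ m k := fun k i =>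
    cell_chain L _ _ (hx1 _) (hz1 _) i
  have e : 2 * d * n * ∑ k, m k = ∑ k : Fin n, ∑ l : Fin n, (d:ℝ) * (m k + m l) := by
    simp only [mul_add, Finset.sum_add_distrib, Finset.sum_const, Finset.card_univ, Fintype.card_fin,
      nsmul_eq_mul, ← Finset.mul_sum]
    ring
  rw [hmt, e, ← Finset.sum_add_distrib]
  refine Finset.sum_le_sum fun k _ => ?_
  rw [← Finset.sum_add_distrib]
  refine Finset.sum_le_sum fun l _ => ?_
  by_cases hkl : k = l
  · simp only [hkl, if_true, zero_add]
    exact mul_nonneg (Nat.cast_nonneg d) (add_nonneg (hm0 _) (hm0 _))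
  · simp only [hkl, if_false]
    refine (abs_sub_le _ (dotd (r.1.2 (r.2.1 k)) (r.1.2 (r.2.1 l))) _).trans ?_
    refine add_le_add le_rfl ?_
    exact dot_diff _ _ _ _ _ _ (hx1 _) (hz1 _) (hch k) (hch l)

lemma pair_unif {n : ℕ} (hn : 0 < n) (k l : Fin n) (hkl : k ≠ l) (g : Fin n → Fin n → ℝ≥0∞) :
    ∫⁻ I, g (I k) (I l) ∂(Measure.pi fun _ : Fin n => uniformFin n) =
      (n:ℝ≥0∞)⁻¹ * (n:ℝ≥0∞)⁻¹ * ∑ i, ∑ j, g i j := by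
  have := uniformFin_prob hn
  have hind : ProbabilityTheory.IndepFun (fun I : Fin n → Fin n => I k) (fun I => I l) (Measure.pi fun _ : Fin n => uniformFin n) := by
    have := ProbabilityTheory.iIndepFun_pi (μ := fun _ : Fin n => uniformFin n) (X := fun _ x => x) (fun _ => aemeasurable_id)
    exact this.indepFun hkl
  have hmap := (ProbabilityTheory.indepFun_iff_map_prod_eq_prod_map_map
    (measurable_pi_apply k).aemeasurable (measurable_pi_apply l).aemeasurable).1 hind
  have hk := (measurePreserving_eval (fun _ : Fin n => uniformFin n) k).map_eq
  have hl := (measurePreserving_eval (fun _ : Fin n => uniformFin n) l).map_eq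
  change Measure.map (fun I : Fin n → Fin n => I k) _ = _ at hk
  change Measure.map (fun I : Fin n → Fin n => I l) _ = _ at hl
  rw [hk, hl] at hmap
  have hf : Measurable fun p : Fin n × Fin n => g p.1 p.2 := measurable_of_countable _
  have e1 : ∫⁻ I, g (I k) (I l) ∂(Measure.pi fun _ : Fin n => uniformFin n) =
      ∫⁻ p, g p.1 p.2 ∂((uniformFin n).prod (uniformFin n)) := by
    rw [← hmap, lintegral_map hf (measurable_of_countable _)]
  have e2 : ∀ f : Fin n → ℝ≥0∞, ∫⁻ i, f i ∂(uniformFin n) = (n:ℝ≥0∞)⁻¹ * ∑ i, f i := by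
    intro f
    unfold uniformFin
    rw [lintegral_smul_measure, lintegral_count, tsum_fintype]
    rw [ENNReal.smul_def, smul_eq_mul, ENNReal.coe_inv (by exact_mod_cast hn.ne')]
    simp
  rw [e1, lintegral_prod _ hf.aemeasurable, e2]
  simp only [e2]
  rw [← Finset.mul_sum, mul_assoc]

lemma meas_mtot {d n : ℕ} (L : ℕ) : Measurable (mtot L : (Fin n → Fin d → ℝ) × (Fin n → Fin n) × (Fin n → Fin d → ℝ) → ℝ) := by
  set h : (Fin n → Fin d → ℤ) × (Fin n → Fin d → ℤ) → ℝ := fun c => ∑ k, ((1/2) ^ L + ∑ l ∈ Finset.range (L+1),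
      2 * (1/2) ^ l * (if coarse L l (c.1 k) ≠ coarse L l (c.2 (sigmaP L c.1 c.2 k)) then (1:ℝ) else 0)) with hh
  have hm : Measurable h := measurable_of_countable _
  have h2 : Measurable fun q : (Fin n → Fin d → ℝ) × (Fin n → Fin n) × (Fin n → Fin d → ℝ) =>
      ((fun k => cellOf L (q.1 (q.2.1 k)), fun k => cellOf L (q.2.2 k)) : (Fin n → Fin d → ℤ) × (Fin n → Fin d → ℤ)) := by
    refine Measurable.prodMk ?_ ?_
    · exact measurable_pi_lambda _ fun k => (measurable_cellOf L).comp (meas_ev k)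
    · exact measurable_pi_lambda _ fun k => (measurable_cellOf L).comp
        ((measurable_pi_apply k).comp (measurable_snd.comp measurable_snd))
  convert hm.comp h2 using 1
  ext q
  simp only [Function.comp, hh, mtot, mism]
  refine Finset.sum_congr rfl fun k _ => ?_
  congr 1
  refine Finset.sum_congr rfl fun l hl => ?_
  have hl' : l ≤ L := by simp at hl; omega
  simp only [coarse_cell L l hl']

lemma gerr_meas {d n : ℕ} (i j : Fin n) :
    Measurable fun b : (Fin n × Fin n → ℝ) × (Fin n → Fin d → ℝ) => gerr b i j := by
  have h1 : Measurable fun b : (Fin n × Fin n → ℝ) × (Fin n → Fin d → ℝ) => ase d (adjOf 1 b.2 b.1) :=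
    meas_of_adj (X := fun b : (Fin n × Fin n → ℝ) × (Fin n → Fin d → ℝ) => b.2) (u := fun b => b.1)
      measurable_snd measurable_fst (ase d)
  have h2 := meas_dotd ((measurable_pi_apply i).comp h1) ((measurable_pi_apply j).comp h1)
  have h3 := meas_dotd ((measurable_pi_apply i).comp measurable_snd) ((measurable_pi_apply j).comp
    (measurable_snd : Measurable fun b : (Fin n × Fin n → ℝ) × (Fin n → Fin d → ℝ) => b.2))
  exact (h2.sub h3).norm

lemma gerr_nonneg {d n : ℕ} (b : (Fin n × Fin n → ℝ) × (Fin n → Fin d → ℝ)) (i j : Fin n) : 0 ≤ gerr b i j :=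
  abs_nonneg _

lemma gerr_base {d n : ℕ} (hn : 0 < n) (hdn : d ≤ n) (F : Measure (Fin d → ℝ)) [IsProbabilityMeasure F]
    (hF : InnerProductDistribution d F) :
    ∫⁻ b, ENNReal.ofReal (∑ i, ∑ j, gerr b i j) ∂((pairUniform n).prod (Measure.pi fun _ : Fin n => F))
      ≤ ENNReal.ofReal (n*(8*d)*(78*Real.sqrt n)) := by
  have hm : Measurable fun b : (Fin n × Fin n → ℝ) × (Fin n → Fin d → ℝ) => ENNReal.ofReal (∑ i, ∑ j, gerr b i j) :=
    (Finset.measurable_sum _ fun i _ => Finset.measurable_sum _ fun j _ => gerr_meas i j).ennreal_ofReal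
  rw [lintegral_prod_symm' _ hm]
  calc _ ≤ ∫⁻ X, ENNReal.ofReal (n*(8*d)*(78*Real.sqrt n)) ∂(Measure.pi fun _ : Fin n => F) := by
        refine lintegral_mono_ae ((msupport_pi_ae n F).mono fun X hX => ?_)
        exact ase_l1 hn hdn X fun i j => hF.2 _ (hX i) _ (hX j)
    _ = _ := by simp

lemma gerr_inner {d n : ℕ} (hn : 0 < n) (b : (Fin n × Fin n → ℝ) × (Fin n → Fin d → ℝ)) :
    ∫⁻ I, ENNReal.ofReal (∑ k, ∑ l, if k = l then 0 else gerr b (I k) (I l)) ∂(Measure.pi fun _ : Fin n => uniformFin n)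
      ≤ ENNReal.ofReal (∑ i, ∑ j, gerr b i j) := by
  have e1 : ∀ I : Fin n → Fin n, ENNReal.ofReal (∑ k, ∑ l, if k = l then 0 else gerr b (I k) (I l)) =
      ∑ k, ∑ l, if k = l then 0 else ENNReal.ofReal (gerr b (I k) (I l)) := by
    intro I
    rw [ENNReal.ofReal_sum_of_nonneg]
    · refine Finset.sum_congr rfl fun k _ => ?_
      rw [ENNReal.ofReal_sum_of_nonneg]
      · refine Finset.sum_congr rfl fun l _ => ?_
        split_ifs <;> simp
      · intro l _; split_ifs
        · exact le_rfl
        · exact gerr_nonneg _ _ _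
    · intro k _
      refine Finset.sum_nonneg fun l _ => ?_
      split_ifs
      · exact le_rfl
      · exact gerr_nonneg _ _ _
  have e2 : ENNReal.ofReal (∑ i, ∑ j, gerr b i j) = ∑ i, ∑ j, ENNReal.ofReal (gerr b i j) := by
    rw [ENNReal.ofReal_sum_of_nonneg (fun i _ => Finset.sum_nonneg fun j _ => gerr_nonneg _ _ _)]
    refine Finset.sum_congr rfl fun k _ => ?_
    rw [ENNReal.ofReal_sum_of_nonneg fun j _ => gerr_nonneg _ _ _]
  simp only [e1, e2]
  rw [lintegral_finsetSum _ fun k _ => measurable_of_countable _]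
  calc _ ≤ ∑ k : Fin n, ∑ l : Fin n, (n:ℝ≥0∞)⁻¹ * (n:ℝ≥0∞)⁻¹ * ∑ i, ∑ j, ENNReal.ofReal (gerr b i j) := by
        refine Finset.sum_le_sum fun k _ => ?_
        rw [lintegral_finsetSum _ fun k _ => measurable_of_countable _]
        refine Finset.sum_le_sum fun l _ => ?_
        by_cases hkl : k = l
        · simp [hkl]
        · simp only [hkl, if_false]
          rw [pair_unif hn k l hkl fun i j => ENNReal.ofReal (gerr b i j)]
    _ = _ := by
        have h0 : (n:ℝ≥0∞) ≠ 0 := by exact_mod_cast hn.ne'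
        have ht : (n:ℝ≥0∞) ≠ ⊤ := ENNReal.natCast_ne_top n
        simp only [Finset.sum_const, Finset.card_univ, Fintype.card_fin, nsmul_eq_mul]
        rw [← mul_assoc, ← mul_assoc, ← mul_assoc, mul_assoc (n:ℝ≥0∞) (n:ℝ≥0∞), ENNReal.mul_inv_cancel h0 ht, mul_one,
          ENNReal.mul_inv_cancel h0 ht, one_mul]

lemma gerr_total {d n : ℕ} (hn : 0 < n) (hdn : d ≤ n) (F : Measure (Fin d → ℝ)) [IsProbabilityMeasure F]
    (hF : InnerProductDistribution d F) :
    ∫⁻ r : RSp d n, ENNReal.ofReal (∑ k, ∑ l, if k = l then 0 else gerr r.1 (r.2.1 k) (r.2.1 l)) ∂(baseM n F)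
      ≤ ENNReal.ofReal (n*(8*d)*(78*Real.sqrt n)) := by
  have := uniformFin_prob hn
  unfold baseM
  refine (lintegral_prod_le _).trans ?_
  refine le_trans ?_ (gerr_base hn hdn F hF)
  refine lintegral_mono fun b => ?_
  refine (lintegral_prod_le _).trans ?_
  refine le_trans (le_of_eq ?_) (gerr_inner hn b)
  simp

lemma mtot_total {d n : ℕ} (hn : 0 < n) (F : Measure (Fin d → ℝ)) [IsProbabilityMeasure F]
    (hF : InnerProductDistribution d F) (L : ℕ) :
    ∫⁻ r : RSp d n, ENNReal.ofReal (mtot L (r.1.2, r.2)) ∂(baseM n F)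
      ≤ ENNReal.ofReal (n * (1/2) ^ L + ∑ l ∈ Finset.range (L+1),
        2 * (1/2) ^ l * (5 * Real.sqrt (n * (3 * 2 ^ l) ^ d))) := by
  have := uniformFin_prob hn
  refine le_trans (le_of_eq ?_) (mism_int hn F hF L)
  have h1 : MeasurePreserving Prod.snd ((pairUniform n).prod (Measure.pi fun _ : Fin n => F)) (Measure.pi fun _ : Fin n => F) :=
    measurePreserving_snd
  have h2 := h1.prod (MeasurePreserving.id ((Measure.pi fun _ : Fin n => uniformFin n).prod (Measure.pi fun _ : Fin n => F)))
  exact h2.lintegral_comp (meas_mtot L).ennreal_ofReal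

lemma mtot_nonneg {d n : ℕ} (L : ℕ) (q : (Fin n → Fin d → ℝ) × (Fin n → Fin n) × (Fin n → Fin d → ℝ)) : 0 ≤ mtot L q :=
  Finset.sum_nonneg fun _ _ => mism_nonneg _ _ _

lemma cost_total {d n : ℕ} (hn : 0 < n) (hdn : d ≤ n) (F : Measure (Fin d → ℝ)) [IsProbabilityMeasure F]
    (hF : InnerProductDistribution d F) (L : ℕ) :
    ∫⁻ p : RSp d n × (Fin n × Fin n → ℝ), ENNReal.ofReal (cost L p) ∂((baseM n F).prod (pairUniform n)) ≤
      ENNReal.ofReal (n*(8*d)*(78*Real.sqrt n) + 2 * d * n * (n * (1/2) ^ L + ∑ l ∈ Finset.range (L+1),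
        2 * (1/2) ^ l * (5 * Real.sqrt (n * (3 * 2 ^ l) ^ d)))) := by
  have := uniformFin_prob hn
  have hgm : Measurable fun r : RSp d n => ENNReal.ofReal (∑ k, ∑ l, if k = l then 0 else gerr r.1 (r.2.1 k) (r.2.1 l)) := by
    refine Measurable.ennreal_ofReal ?_
    refine Finset.measurable_sum _ fun k _ => Finset.measurable_sum _ fun l _ => ?_
    by_cases hkl : k = l
    · simp [hkl]
    · simp only [hkl, if_false]
      have h1 := meas_dotd ((measurable_pi_apply k).comp (meas_bootY (d := d) (n := n))) ((measurable_pi_apply l).comp meas_bootY)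
      have h2 := meas_dotd (meas_XI (d := d) k) (meas_XI l)
      exact (h1.sub h2).norm
  have hX : ∀ᵐ r ∂(baseM n F), ∀ k, r.1.2 k ∈ msupport F :=
    (measurePreserving_snd.comp measurePreserving_fst : MeasurePreserving (fun r : RSp d n => r.1.2) (baseM n F) (Measure.pi fun _ : Fin n => F)).quasiMeasurePreserving.ae (msupport_pi_ae n F)
  have hZ : ∀ᵐ r ∂(baseM n F), ∀ k, r.2.2 k ∈ msupport F :=
    (measurePreserving_snd.comp measurePreserving_snd : MeasurePreserving (fun r : RSp d n => r.2.2) (baseM n F) (Measure.pi fun _ : Fin n => F)).quasiMeasurePreserving.ae (msupport_pi_ae n F)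
  refine (lintegral_prod_le _).trans ?_
  calc _ ≤ ∫⁻ r : RSp d n, ENNReal.ofReal (pdis L r) ∂(baseM n F) := lintegral_mono fun r => cost_inner L r
    _ ≤ ∫⁻ r : RSp d n, (ENNReal.ofReal (∑ k, ∑ l, if k = l then 0 else gerr r.1 (r.2.1 k) (r.2.1 l)) +
          ENNReal.ofReal (2 * d * n) * ENNReal.ofReal (mtot L (r.1.2, r.2))) ∂(baseM n F) := by
        refine lintegral_mono_ae ?_
        filter_upwards [hX, hZ] with r h1 h2
        rw [← ENNReal.ofReal_mul (by positivity), ← ENNReal.ofReal_add]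
        · exact ENNReal.ofReal_le_ofReal (pdis_le F hF L r h1 h2)
        · refine Finset.sum_nonneg fun k _ => Finset.sum_nonneg fun l _ => ?_
          split_ifs
          · exact le_rfl
          · exact gerr_nonneg _ _ _
        · exact mul_nonneg (by positivity) (mtot_nonneg _ _)
    _ = (∫⁻ r : RSp d n, ENNReal.ofReal (∑ k, ∑ l, if k = l then 0 else gerr r.1 (r.2.1 k) (r.2.1 l)) ∂(baseM n F)) +
          ENNReal.ofReal (2 * d * n) * ∫⁻ r : RSp d n, ENNReal.ofReal (mtot L (r.1.2, r.2)) ∂(baseM n F) := by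
        rw [lintegral_add_left hgm, lintegral_const_mul' _ _ ENNReal.ofReal_ne_top]
    _ ≤ ENNReal.ofReal (n*(8*d)*(78*Real.sqrt n)) + ENNReal.ofReal (2 * d * n) *
        ENNReal.ofReal (n * (1/2) ^ L + ∑ l ∈ Finset.range (L+1),
        2 * (1/2) ^ l * (5 * Real.sqrt (n * (3 * 2 ^ l) ^ d))) := by
        gcongr
        · exact gerr_total hn hdn F hF
        · exact mtot_total hn F hF L
    _ = _ := by
        rw [← ENNReal.ofReal_mul (by positivity), ← ENNReal.ofReal_add (by positivity) (by positivity)]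

lemma meas_dGM {n : ℕ} : Measurable fun q : (Fin n → Fin n → ℝ) × (Fin n → Fin n → ℝ) => dGM q.1 q.2 := by
  unfold dGM
  refine Measurable.iInf fun σ => ?_
  refine Measurable.div_const (Measurable.const_mul ?_ _) _
  refine Finset.measurable_sum _ fun i _ => Finset.measurable_sum _ fun j _ => ?_
  have h1 : Measurable fun q : (Fin n → Fin n → ℝ) × (Fin n → Fin n → ℝ) => q.1 i j :=
    (measurable_pi_apply j).comp ((measurable_pi_apply i).comp measurable_fst)
  have h2 : Measurable fun q : (Fin n → Fin n → ℝ) × (Fin n → Fin n → ℝ) => q.2 (σ i) (σ j) :=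
    (measurable_pi_apply (σ j)).comp ((measurable_pi_apply (σ i)).comp measurable_snd)
  exact (h1.sub h2).norm

lemma dGM_nonneg {n : ℕ} (A B : Fin n → Fin n → ℝ) : 0 ≤ dGM A B :=
  Real.iInf_nonneg fun σ => by positivity

lemma dGM_le {n : ℕ} (A B : Fin n → Fin n → ℝ) (σ : Equiv.Perm (Fin n)) :
    dGM A B ≤ ((n.choose 2 : ℝ))⁻¹ * (∑ i, ∑ j, |A i j - B (σ i) (σ j)|) / 2 :=
  ciInf_le ⟨0, by rintro _ ⟨σ, rfl⟩; positivity⟩ σ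

lemma dGM_le_one {d n : ℕ} (hn : 2 ≤ n) (X Y : Fin n → Fin d → ℝ) (u v : Fin n × Fin n → ℝ) :
    dGM (adjOf 1 X u) (adjOf 1 Y v) ≤ 1 := by
  refine (dGM_le _ _ (Equiv.refl _)).trans ?_
  have h1 : ∑ i, ∑ j, |adjOf 1 X u i j - adjOf 1 Y v ((Equiv.refl (Fin n)) i) ((Equiv.refl (Fin n)) j)| ≤
      ∑ i : Fin n, ∑ j : Fin n, (1 - if i = j then (1:ℝ) else 0) := by
    refine Finset.sum_le_sum fun i _ => Finset.sum_le_sum fun j _ => ?_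
    simp only [Equiv.refl_apply, adjOf]
    by_cases hij : i = j
    · simp [hij]
    · simp only [hij, if_false, sub_zero]
      have hh : ∀ (P Q : Prop) [Decidable P] [Decidable Q],
          |(if P then (1:ℝ) else 0) - (if Q then 1 else 0)| ≤ 1 := by
        intro P Q _ _
        by_cases hP : P <;> by_cases hQ : Q <;> simp [hP, hQ]
      exact hh _ _
  have h2 : ∑ i : Fin n, ∑ j : Fin n, (1 - if i = j then (1:ℝ) else 0) = n * (n - 1) := by
    simp [Finset.sum_sub_distrib]
    ring
  have h3 : (n.choose 2 : ℝ) = n * (n - 1) / 2 := Nat.cast_choose_two ℝ n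
  have h4 : (0:ℝ) < n.choose 2 := by exact_mod_cast Nat.choose_pos hn
  rw [div_le_one (by norm_num), inv_mul_le_iff₀ h4]
  rw [h2] at h1
  linarith

lemma WGM_le {d n : ℕ} (hn : 2 ≤ n) (hdn : d ≤ n) (F : Measure (Fin d → ℝ)) [IsProbabilityMeasure F]
    (hF : InnerProductDistribution d F) (L : ℕ) (p : ℝ) (hp : 1 ≤ p) :
    WGMpow p (bootLaw d n F) (adjLaw d n F) ≤ ((n.choose 2 : ℝ))⁻¹ / 2 *
      (n*(8*d)*(78*Real.sqrt n) + 2 * d * n * (n * (1/2) ^ L + ∑ l ∈ Finset.range (L+1),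
        2 * (1/2) ^ l * (5 * Real.sqrt (n * (3 * 2 ^ l) ^ d)))) := by
  have hn0 : 0 < n := by omega
  have := baseM_prob hn0 F
  set M := (baseM n F).prod (pairUniform n) with hM
  have hA : Measurable (cplA : RSp d n × _ → _) := meas_cplA
  have hH : Measurable (cplH L : RSp d n × _ → _) := meas_cplH hn0 L F
  set γ := M.map (fun p : RSp d n × (Fin n × Fin n → ℝ) => (cplA p, cplH L p)) with hγ
  have hc : γ ∈ Couplings (bootLaw d n F) (adjLaw d n F) := by
    refine ⟨Measure.isProbabilityMeasure_map (hA.prodMk hH).aemeasurable, ?_, ?_⟩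
    · rw [hγ, Measure.map_map measurable_fst (hA.prodMk hH), ← map_cplA hn0 F]
      rfl
    · rw [hγ, Measure.map_map measurable_snd (hA.prodMk hH), ← map_cplH hn0 L F]
      rfl
  have h1 : WGMpow p (bootLaw d n F) (adjLaw d n F) ≤ ∫ q, dGM q.1 q.2 ^ p ∂γ := by
    refine csInf_le ⟨0, ?_⟩ ⟨γ, hc, rfl⟩
    rintro _ ⟨γ', _, rfl⟩
    exact integral_nonneg fun q => Real.rpow_nonneg (dGM_nonneg _ _) _
  refine h1.trans ?_
  have hm : Measurable fun q : (Fin n → Fin n → ℝ) × (Fin n → Fin n → ℝ) => dGM q.1 q.2 ^ p :=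
    meas_dGM.pow_const p
  rw [hγ, integral_map (hA.prodMk hH).aemeasurable hm.aestronglyMeasurable,
    integral_eq_lintegral_of_nonneg_ae (Filter.Eventually.of_forall fun q => Real.rpow_nonneg (dGM_nonneg _ _) _)
      (hm.comp (hA.prodMk hH)).aestronglyMeasurable]
  refine ENNReal.toReal_le_of_le_ofReal (by positivity) ?_
  rw [ENNReal.ofReal_mul (by positivity)]
  refine le_trans ?_ (mul_le_mul_right (cost_total hn0 hdn F hF L) _)
  rw [← lintegral_const_mul' _ _ ENNReal.ofReal_ne_top]
  refine lintegral_mono fun q => ?_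
  rw [← ENNReal.ofReal_mul (by positivity)]
  refine ENNReal.ofReal_le_ofReal ?_
  have h5 : dGM (cplA q) (cplH L q) ^ p ≤ dGM (cplA q) (cplH L q) := by
    have := Real.rpow_le_rpow_of_exponent_ge' (dGM_nonneg (cplA q) (cplH L q)) (dGM_le_one hn _ _ _ _) zero_le_one hp
    rwa [Real.rpow_one] at this
  refine h5.trans ((dGM_le _ _ (sig L q.1)).trans (le_of_eq ?_))
  unfold cost
  ring

lemma WGM_nonneg {n : ℕ} (p : ℝ) (μ ν : Measure (Fin n → Fin n → ℝ)) : 0 ≤ WGMpow p μ ν := by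
  refine Real.sInf_nonneg ?_
  rintro _ ⟨γ', _, rfl⟩
  exact integral_nonneg fun q => Real.rpow_nonneg (dGM_nonneg _ _) _

lemma level_bound {d n L l : ℕ} (hd : 0 < d) (hn : 0 < n) (hl : l ≤ L) (hL : 2 ^ (L * d) ≤ n) :
    (1/2:ℝ) ^ l * Real.sqrt (n * (3 * 2 ^ l) ^ d) ≤
      n * 3 ^ d * ((n:ℝ) ^ (-(1/2:ℝ)) + (1/2) ^ L) := by
  have hn' : (0:ℝ) < n := by exact_mod_cast hn
  have hs : (n:ℝ) ^ (-(1/2:ℝ)) = 1 / Real.sqrt n := by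
    rw [Real.rpow_neg hn'.le, ← Real.sqrt_eq_rpow, one_div]
  have hsn : Real.sqrt n * Real.sqrt n = n := Real.mul_self_sqrt hn'.le
  have hsp : 0 < Real.sqrt n := Real.sqrt_pos.2 hn'
  have hLr : (2:ℝ) ^ (L * d) ≤ n := by exact_mod_cast hL
  have h3 : (1:ℝ) ≤ 3 ^ d := one_le_pow₀ (by norm_num)
  have hsplit : Real.sqrt (n * (3 * 2 ^ l) ^ d) ≤ 3 ^ d * Real.sqrt (n * 2 ^ (l * d)) := by
    apply Real.sqrt_le_iff.2
    refine ⟨by positivity, ?_⟩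
    rw [mul_pow (3 ^ d : ℝ), Real.sq_sqrt (by positivity), mul_pow, ← pow_mul]
    have hk : (3:ℝ) ^ d ≤ (3 ^ d) ^ 2 := by nlinarith
    calc (n:ℝ) * (3 ^ d * 2 ^ (l * d)) = 3 ^ d * (n * 2 ^ (l * d)) := by ring
      _ ≤ _ := by gcongr
  have hmain : (1/2:ℝ) ^ l * Real.sqrt (n * 2 ^ (l * d)) ≤ Real.sqrt n + n * (1/2) ^ L := by
    rcases Nat.lt_or_ge d 2 with h2 | h2
    · have hd1 : d = 1 := by omega
      subst hd1
      refine le_trans ?_ (le_add_of_nonneg_right (by positivity))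
      rw [Real.sqrt_mul hn'.le, mul_one]
      have : (1/2:ℝ) ^ l * Real.sqrt (2 ^ l) ≤ 1 := by
        have h6 : Real.sqrt (2 ^ l) ≤ 2 ^ l := by
          apply Real.sqrt_le_iff.2
          refine ⟨by positivity, ?_⟩
          nlinarith [one_le_pow₀ (M₀ := ℝ) (a := 2) (by norm_num) (n := l)]
        calc _ ≤ (1/2:ℝ) ^ l * 2 ^ l := by gcongr
          _ = 1 := by rw [← mul_pow]; norm_num
      nlinarith
    · refine le_trans ?_ (le_add_of_nonneg_left (by positivity))
      have h7 : Real.sqrt (n * 2 ^ (l * d)) ≤ n * (1/2) ^ L * 2 ^ l := by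
        apply Real.sqrt_le_iff.2
        refine ⟨by positivity, ?_⟩
        obtain ⟨e, rfl⟩ : ∃ e, d = e + 2 := ⟨d - 2, by omega⟩
        have h8 : (2:ℝ) ^ (l * e) ≤ 2 ^ (L * e) := by
          apply pow_le_pow_right₀ (by norm_num); gcongr
        have h9 : (2:ℝ) ^ (L * e) * (2 ^ L) ^ 2 ≤ n := by
          refine le_trans (le_of_eq ?_) hLr
          rw [← pow_mul, ← pow_add]; congr 1; ring
        have h10 : (2:ℝ) ^ (l * (e+2)) = 2 ^ (l * e) * (2 ^ l) ^ 2 := by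
          rw [← pow_mul, ← pow_add]; congr 1; ring
        rw [h10]
        have h11 : (2:ℝ) ^ (l * e) ≤ n * ((1/2) ^ L) ^ 2 := by
          have h12 : ((2:ℝ) ^ L) ^ 2 * ((1/2) ^ L) ^ 2 = 1 := by
            rw [← mul_pow, ← mul_pow]; norm_num
          calc (2:ℝ) ^ (l * e) ≤ 2 ^ (L * e) := h8
            _ = 2 ^ (L * e) * (2 ^ L) ^ 2 * ((1/2) ^ L) ^ 2 := by rw [mul_assoc, h12, mul_one]
            _ ≤ _ := by gcongr
        calc (n:ℝ) * (2 ^ (l * e) * (2 ^ l) ^ 2) ≤ n * (n * ((1/2) ^ L) ^ 2 * (2 ^ l) ^ 2) := by gcongr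
          _ = _ := by ring
      calc _ ≤ (1/2:ℝ) ^ l * (n * (1/2) ^ L * 2 ^ l) := by gcongr
        _ = n * (1/2) ^ L * ((1/2) ^ l * 2 ^ l) := by ring
        _ = _ := by rw [← mul_pow]; norm_num
  have hns : n * (1 / Real.sqrt n) = Real.sqrt n := by
    field_simp; rw [pow_two, hsn]
  calc _ ≤ (1/2:ℝ) ^ l * (3 ^ d * Real.sqrt (n * 2 ^ (l * d))) := by gcongr
    _ = 3 ^ d * ((1/2:ℝ) ^ l * Real.sqrt (n * 2 ^ (l * d))) := by ring
    _ ≤ 3 ^ d * (Real.sqrt n + n * (1/2) ^ L) := by gcongr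
    _ = _ := by rw [hs, mul_comm (n:ℝ) (3 ^ d), mul_assoc (3 ^ d : ℝ), mul_add (n:ℝ), hns]

lemma numeric {d n : ℕ} (hd : 0 < d) (hn : 3 ≤ n) : ∃ L : ℕ,
    ((n.choose 2 : ℝ))⁻¹ / 2 *
      (n*(8*d)*(78*Real.sqrt n) + 2 * d * n * (n * (1/2) ^ L + ∑ l ∈ Finset.range (L+1),
        2 * (1/2) ^ l * (5 * Real.sqrt (n * (3 * 2 ^ l) ^ d)))) ≤
    (1256 * d + 240 * d * 3 ^ d) * (((n : ℝ) ^ (-(1/2 : ℝ)) + (n : ℝ) ^ (-(1/(d : ℝ)))) * Real.log n) := by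
  have hn0 : 0 < n := by omega
  have hn' : (0:ℝ) < n := by exact_mod_cast hn0
  have hn3 : (3:ℝ) ≤ n := by exact_mod_cast hn
  have hd' : (0:ℝ) < d := by exact_mod_cast hd
  set L := Nat.log 2 n / d with hL
  have hLd : L * d ≤ Nat.log 2 n := Nat.div_mul_le_self _ _
  have hpow : 2 ^ (L * d) ≤ n :=
    (Nat.pow_le_pow_right (by norm_num) hLd).trans (Nat.pow_log_le_self 2 (by omega))
  have hup : n < 2 ^ ((L + 1) * d) := by
    refine (Nat.lt_pow_succ_log_self (b := 2) (by norm_num) n).trans_le ?_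
    refine Nat.pow_le_pow_right (by norm_num) ?_
    have := Nat.lt_div_mul_add hd (a := Nat.log 2 n)
    rw [← hL] at this
    rw [add_mul]; omega
  set s := (n : ℝ) ^ (-(1/2 : ℝ)) with hs
  set t := (n : ℝ) ^ (-(1/(d : ℝ))) with ht
  have hs0 : 0 ≤ s := by positivity
  have ht0 : 0 ≤ t := by positivity
  have hlog : 1 ≤ Real.log n := by
    rw [Real.le_log_iff_exp_le hn']
    linarith [Real.exp_one_lt_d9]
  have hLt : (1/2:ℝ) ^ L ≤ 2 * t := by
    have h1 : (n:ℝ) ^ (1/(d:ℝ)) ≤ 2 ^ (L + 1) := by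
      have h2 : (n:ℝ) ≤ (2 ^ (L+1)) ^ (d:ℝ) := by
        rw [Real.rpow_natCast, ← pow_mul]; exact_mod_cast hup.le
      calc (n:ℝ) ^ (1/(d:ℝ)) ≤ ((2 ^ (L+1)) ^ (d:ℝ)) ^ (1/(d:ℝ)) := by gcongr
        _ = 2 ^ (L+1) := by
          rw [← Real.rpow_mul (by positivity), mul_one_div_cancel hd'.ne', Real.rpow_one]
    rw [ht, Real.rpow_neg hn'.le]
    have h3 : (0:ℝ) < (n:ℝ) ^ (1/(d:ℝ)) := by positivity
    have h4 : ((2:ℝ) ^ (L + 1))⁻¹ ≤ ((n:ℝ) ^ (1/(d:ℝ)))⁻¹ := inv_anti₀ h3 h1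
    have h5 : (1/2:ℝ) ^ L = 2 * (2 ^ (L+1))⁻¹ := by
      rw [pow_succ, one_div, inv_pow]; field_simp
    rw [h5]; linarith
  have hLlog : (L:ℝ) + 1 ≤ 3 * Real.log n := by
    have h1 : (L:ℝ) ≤ Nat.log 2 n := by exact_mod_cast Nat.div_le_self _ _
    have h2 : (Nat.log 2 n : ℝ) * Real.log 2 ≤ Real.log n := by
      rw [← Real.log_pow]
      apply Real.log_le_log (by positivity)
      exact_mod_cast Nat.pow_log_le_self 2 (by omega)
    have h3 := Real.log_two_gt_d9
    have h4 : (0:ℝ) ≤ Nat.log 2 n := by positivity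
    nlinarith
  have hss : Real.sqrt n = n * s := by
    rw [hs, Real.rpow_neg hn'.le, ← Real.sqrt_eq_rpow]
    field_simp
    exact Real.sq_sqrt hn'.le
  have hc : ((n.choose 2 : ℝ))⁻¹ / 2 ≤ 2 / (n * n) := by
    rw [Nat.cast_choose_two ℝ n]
    have e : ((n:ℝ) * (n - 1) / 2)⁻¹ / 2 = 1 / (n * (n - 1)) := by
      have : (n:ℝ) - 1 ≠ 0 := by linarith
      field_simp
    rw [e, div_le_div_iff₀ (by nlinarith) (by positivity)]
    nlinarith
  refine ⟨L, ?_⟩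
  have hsum : ∑ l ∈ Finset.range (L+1), 2 * (1/2:ℝ) ^ l * (5 * Real.sqrt (n * (3 * 2 ^ l) ^ d)) ≤
      (L + 1) * (10 * (n * 3 ^ d * (s + (1/2) ^ L))) := by
    calc _ ≤ ∑ l ∈ Finset.range (L+1), 10 * (n * 3 ^ d * (s + (1/2) ^ L)) := by
          refine Finset.sum_le_sum fun l hl => ?_
          have := level_bound hd hn0 (show l ≤ L by simp at hl; omega) hpow
          rw [← hs] at this
          linarith
      _ = _ := by simp
  calc _ ≤ 2 / ((n:ℝ) * n) * (n*(8*d)*(78*(n * s)) + 2 * d * n * (n * (2 * t) +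
        (3 * Real.log n) * (10 * (n * 3 ^ d * (s + 2 * t))))) := by
        have hq : ∑ l ∈ Finset.range (L+1), 2 * (1/2:ℝ) ^ l * (5 * Real.sqrt (n * (3 * 2 ^ l) ^ d)) ≤
          (3 * Real.log n) * (10 * (n * 3 ^ d * (s + 2 * t))) := hsum.trans (by gcongr)
        rw [← hss]
        gcongr
    _ = 1248 * d * s + 8 * d * t + 120 * d * 3 ^ d * Real.log n * (s + 2 * t) := by
        field_simp
        ring
    _ ≤ _ := by
        have e1 : 1248 * d * s ≤ 1256 * d * s * Real.log n := by
          have := mul_nonneg hd'.le hs0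
          nlinarith
        have e2 : 8 * d * t ≤ 1256 * d * t * Real.log n := by
          have := mul_nonneg hd'.le ht0
          nlinarith
        have e3 : 120 * d * 3 ^ d * Real.log n * (s + 2 * t) ≤ 120 * d * 3 ^ d * Real.log n * (2 * (s + t)) := by
          gcongr
          linarith
        linarith

open Asymptotics in
/-- Theorem `RDPGboot:wasser`: the bootstrapped network `Â* ~ RDPG(F̂_n, n)`,
generated from the empirical distribution of the adjacency spectral embedding of
`A ~ RDPG(F,n)`, satisfies `W_{GM,p}^p(Â*, H) = O((n^{-1/2} + n^{-1/d}) log n)` where `H` is an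
independent copy of `A`. -/
theorem bootstrap_network_wasserstein_rate
    {d : ℕ} (hd : 0 < d) (F : Measure (Fin d → ℝ)) [IsProbabilityMeasure F]
    (hF : InnerProductDistribution d F) :
    ∀ p : ℝ, 1 ≤ p →
      (fun n : ℕ => WGMpow p (bootLaw d n F) (adjLaw d n F)) =O[atTop]
        fun n : ℕ =>
          ((n : ℝ) ^ (-(1/2 : ℝ)) + (n : ℝ) ^ (-(1/(d : ℝ)))) * Real.log n := by
  intro p hp
  refine IsBigO.of_bound (1256 * d + 240 * d * 3 ^ d) ?_
  filter_upwards [eventually_ge_atTop (max d 3)] with n hn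
  have h3 : 3 ≤ n := (le_max_right _ _).trans hn
  obtain ⟨L, hL⟩ := numeric hd h3
  rw [Real.norm_of_nonneg (WGM_nonneg _ _ _)]
  refine ((WGM_le (by omega) ((le_max_left _ _).trans hn) F hF L p hp).trans hL).trans ?_
  gcongr
  exact le_abs_self _


end
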